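/- For every SKS derivation Φ, there exists a hyper-streamlined SKS derivation with the same premiss and the same conclusion as Φ. -/

import Mathlib

set_option linter.unusedVariables false

namespace AF

/-! ### Formulae of system SKS.

Atoms are pairs `(n, b)`; the involution `ā` flips the Boolean, so it is
fixed-point free. -/

inductive Formula : Type
  | tt : Formula
  | ff : Formula
  | atom : ℕ → Bool → Formula
  | or : Formula → Formula → Formula
  | and : Formula → Formula → Formula
  deriving DecidableEq

namespace Formula

/-- Subformula at a position (`false` = left child, `true` = right child). -/
def sub : Formula → List Bool → Option Formula
  | φ, [] => some φ
  | .or α _, false :: p => sub α p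
  | .or _ β, true :: p => sub β p
  | .and α _, false :: p => sub α p
  | .and _ β, true :: p => sub β p
  | _, _ :: _ => none

/-- Replace the subformula at a position. -/
def repl : Formula → List Bool → Formula → Formula
  | _, [], ψ => ψ
  | .or α β, false :: p, ψ => .or (repl α p ψ) β
  | .or α β, true :: p, ψ => .or α (repl β p ψ)
  | .and α β, false :: p, ψ => .and (repl α p ψ) β
  | .and α β, true :: p, ψ => .and α (repl β p ψ)
  | φ, _ :: _, _ => φ

/-- `p` is an atom occurrence of `φ`. -/
def IsOcc (φ : Formula) (p : List Bool) : Prop :=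
  ∃ n b, φ.sub p = some (.atom n b)

end Formula

/-! ### Inference rules.

The rule `=` of SKS replaces a formula by an equivalent one under
commutativity, associativity and the unit equations; each single instance of
`=` applies one equation (in either direction), so we list the equations as
individual rule names, all marked as being instances of `=` via `isEq`. -/

inductive RuleName : Type
  | aiDown | aiUp | awDown | awUp | acDown | acUp
  | s | m
  | eqOrComm | eqAndComm
  | eqOrAssocL | eqOrAssocR | eqAndAssocL | eqAndAssocR
  | eqOrUnitDel | eqOrUnitAdd | eqAndUnitDel | eqAndUnitAdd
  | eqTTDel | eqTTAdd | eqFFDel | eqFFAdd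
  deriving DecidableEq

namespace RuleName

/-- The atomic structural rules. -/
def isStructural : RuleName → Bool
  | .aiDown | .aiUp | .awDown | .awUp | .acDown | .acUp => true
  | _ => false

/-- The rule names that are instances of the rule `=`. -/
def isEq : RuleName → Bool
  | .aiDown | .aiUp | .awDown | .awUp | .acDown | .acUp | .s | .m => false
  | _ => true

end RuleName

/-- Rule instances (redex ⟹ contractum). -/
inductive RuleInstance : RuleName → Formula → Formula → Prop
  | aiDown (n : ℕ) (b : Bool) :
      RuleInstance .aiDown .tt (.or (.atom n b) (.atom n (!b)))
  | aiUp (n : ℕ) (b : Bool) :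
      RuleInstance .aiUp (.and (.atom n b) (.atom n (!b))) .ff
  | awDown (n : ℕ) (b : Bool) : RuleInstance .awDown .ff (.atom n b)
  | awUp (n : ℕ) (b : Bool) : RuleInstance .awUp (.atom n b) .tt
  | acDown (n : ℕ) (b : Bool) :
      RuleInstance .acDown (.or (.atom n b) (.atom n b)) (.atom n b)
  | acUp (n : ℕ) (b : Bool) :
      RuleInstance .acUp (.atom n b) (.and (.atom n b) (.atom n b))
  | s (α β γ : Formula) :
      RuleInstance .s (.and α (.or β γ)) (.or (.and α β) γ)
  | m (α β γ δ : Formula) :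
      RuleInstance .m (.or (.and α β) (.and γ δ)) (.and (.or α γ) (.or β δ))
  | eqOrComm (α β : Formula) : RuleInstance .eqOrComm (.or α β) (.or β α)
  | eqAndComm (α β : Formula) : RuleInstance .eqAndComm (.and α β) (.and β α)
  | eqOrAssocL (α β γ : Formula) :
      RuleInstance .eqOrAssocL (.or (.or α β) γ) (.or α (.or β γ))
  | eqOrAssocR (α β γ : Formula) :
      RuleInstance .eqOrAssocR (.or α (.or β γ)) (.or (.or α β) γ)
  | eqAndAssocL (α β γ : Formula) :
      RuleInstance .eqAndAssocL (.and (.and α β) γ) (.and α (.and β γ))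
  | eqAndAssocR (α β γ : Formula) :
      RuleInstance .eqAndAssocR (.and α (.and β γ)) (.and (.and α β) γ)
  | eqOrUnitDel (α : Formula) : RuleInstance .eqOrUnitDel (.or α .ff) α
  | eqOrUnitAdd (α : Formula) : RuleInstance .eqOrUnitAdd α (.or α .ff)
  | eqAndUnitDel (α : Formula) : RuleInstance .eqAndUnitDel (.and α .tt) α
  | eqAndUnitAdd (α : Formula) : RuleInstance .eqAndUnitAdd α (.and α .tt)
  | eqTTDel : RuleInstance .eqTTDel (.or .tt .tt) .tt
  | eqTTAdd : RuleInstance .eqTTAdd .tt (.or .tt .tt)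
  | eqFFDel : RuleInstance .eqFFDel (.and .ff .ff) .ff
  | eqFFAdd : RuleInstance .eqFFAdd .ff (.and .ff .ff)

/-- One (deep) inference step applying rule `r` at position `q`. -/
def StepAt (r : RuleName) (q : List Bool) (φ ψ : Formula) : Prop :=
  ∃ γ δ, φ.sub q = some γ ∧ RuleInstance r γ δ ∧ ψ = φ.repl q δ

/-- One inference step using a rule from the set `S`. -/
def Step (S : Set RuleName) (φ ψ : Formula) : Prop :=
  ∃ r ∈ S, ∃ q, StepAt r q φ ψ

/-- There is a derivation from `φ` to `ψ` using only rules from `S`. -/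
def Derives (S : Set RuleName) : Formula → Formula → Prop :=
  Relation.ReflTransGen (Step S)

/-! ### Derivations as explicit data (for the theory of atomic flows). -/

/-- A derivation: a premiss and a chain of steps, each recorded by its rule
name, the position of the redex, and the resulting formula. -/
structure Deriv : Type where
  prem : Formula
  steps : List (RuleName × List Bool × Formula)

namespace Deriv

/-- The `i`-th step datum. -/
def stepAt (Φ : Deriv) (i : ℕ) : RuleName × List Bool × Formula :=
  Φ.steps.getD i (RuleName.s, ([] : List Bool), Formula.tt)

/-- The `i`-th formula of the derivation (`0` is the premiss). -/
def fml (Φ : Deriv) (i : ℕ) : Formula :=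
  (Φ.prem :: Φ.steps.map (fun t => t.2.2)).getD i Φ.prem

/-- Number of formulae in the derivation. -/
def nf (Φ : Deriv) : ℕ := Φ.steps.length + 1

/-- The conclusion of the derivation. -/
def concl (Φ : Deriv) : Formula := Φ.fml Φ.steps.length

/-- The derivation is well formed: every recorded step is a correct
inference step of SKS. -/
def WF (Φ : Deriv) : Prop :=
  ∀ i, i < Φ.steps.length →
    StepAt (Φ.stepAt i).1 (Φ.stepAt i).2.1 (Φ.fml i) (Φ.fml (i + 1))

end Deriv

/-! ### Atomic flows. -/

inductive FlowLabel : Type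
  | aiDown | aiUp | awDown | awUp | acDown | acUp
  deriving DecidableEq

/-- Required (number of lower edges, number of upper edges) of a vertex. -/
def labDeg : FlowLabel → ℕ × ℕ
  | .aiDown => (2, 0)
  | .aiUp => (0, 2)
  | .awDown => (1, 0)
  | .awUp => (0, 1)
  | .acDown => (1, 2)
  | .acUp => (2, 1)

/-- The data of an atomic flow: vertices, edges, labels, and the two
endpoint maps.  `up e = none` means the upper endpoint is `⊤`, and
`lo e = none` means the lower endpoint is `⊥`. -/
structure PreFlow : Type where
  V : Finset ℕ
  E : Finset ℕ
  η : ℕ → FlowLabel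
  up : ℕ → Option ℕ
  lo : ℕ → Option ℕ

namespace PreFlow

/-- Lower edges of a vertex. -/
def Ledges (F : PreFlow) (v : ℕ) : Finset ℕ :=
  F.E.filter (fun e => F.up e = some v)

/-- Upper edges of a vertex. -/
def Uedges (F : PreFlow) (v : ℕ) : Finset ℕ :=
  F.E.filter (fun e => F.lo e = some v)

/-- All edges of a vertex. -/
def edges (F : PreFlow) (v : ℕ) : Finset ℕ := F.Ledges v ∪ F.Uedges v

def degOK (F : PreFlow) : Prop :=
  ∀ v ∈ F.V, (F.Ledges v).card = (labDeg (F.η v)).1 ∧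
    (F.Uedges v).card = (labDeg (F.η v)).2

def endpointsOK (F : PreFlow) : Prop :=
  ∀ e ∈ F.E, (∀ v, F.up e = some v → v ∈ F.V) ∧
    (∀ v, F.lo e = some v → v ∈ F.V)

/-- No cyclic sequence of edges `ε₁, …, ε_h` with
`up (ε_i) = lo (ε_(i+1 mod h))`. -/
def Acyclic (F : PreFlow) : Prop :=
  ¬ ∃ (h : ℕ) (ε : Fin (h + 1) → ℕ), (∀ i, ε i ∈ F.E) ∧
      ∀ i : Fin (h + 1), (F.up (ε i)).isSome ∧ F.up (ε i) = F.lo (ε (i + 1))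

/-- `π` is a polarity assignment (`false` = `−`, `true` = `+`). -/
def PolarityOK (F : PreFlow) (π : ℕ → Bool) : Prop :=
  ∀ v ∈ F.V,
    ((F.η v = .acDown ∨ F.η v = .acUp) →
      ∀ e₁ ∈ F.edges v, ∀ e₂ ∈ F.edges v, π e₁ = π e₂) ∧
    ((F.η v = .aiDown ∨ F.η v = .aiUp) →
      ∃ e₁ ∈ F.edges v, ∃ e₂ ∈ F.edges v, π e₁ ≠ π e₂)

/-- `F` is an atomic flow. -/
def IsFlow (F : PreFlow) : Prop :=
  F.degOK ∧ F.endpointsOK ∧ F.Acyclic ∧ ∃ π, F.PolarityOK π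

end PreFlow

/-! ### Paths, ai-paths, cycles. -/

/-- An endpoint of a path: a vertex, or `⊤`, or `⊥`. -/
inductive VPt : Type
  | ver : ℕ → VPt
  | top : VPt
  | bot : VPt
  deriving DecidableEq

/-- The upper endpoint of edge `e` is `ν`. -/
def srcOK (F : PreFlow) (ν : VPt) (e : ℕ) : Prop :=
  match ν with
  | .ver v => F.up e = some v
  | .top => F.up e = none
  | .bot => False

/-- The lower endpoint of edge `e` is `ν`. -/
def tgtOK (F : PreFlow) (ν : VPt) (e : ℕ) : Prop :=
  match ν with
  | .ver v => F.lo e = some v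
  | .bot => F.lo e = none
  | .top => False

/-- A downward path from `ν` to `ν'` (a nonempty sequence of edges, each
hanging from the lower endpoint of the previous one). -/
def IsDownPath (F : PreFlow) (ν ν' : VPt) (l : List ℕ) : Prop :=
  l ≠ [] ∧ (∀ e ∈ l, e ∈ F.E) ∧
  (∀ i, i + 1 < l.length →
    ∃ v ∈ F.V, F.lo (l.getD i 0) = some v ∧ F.up (l.getD (i + 1) 0) = some v) ∧
  srcOK F ν (l.getD 0 0) ∧ tgtOK F ν' (l.getD (l.length - 1) 0)

/-- A path from `ν` to `ν'`: a downward path, or the reverse of a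
downward path from `ν'` to `ν`. -/
def IsPath (F : PreFlow) (ν ν' : VPt) (l : List ℕ) : Prop :=
  IsDownPath F ν ν' l ∨ IsDownPath F ν' ν l.reverse

/-- ai-paths: paths, closed under concatenation (in distinct edges) at
interaction and cointeraction vertices. -/
inductive AIPath (F : PreFlow) : VPt → VPt → List ℕ → Prop
  | single {ν ν' : VPt} {l : List ℕ} : IsPath F ν ν' l → AIPath F ν ν' l
  | join {ν ν' : VPt} {v : ℕ} {l₁ l₂ : List ℕ} {e e' : ℕ} :
      v ∈ F.V → (F.η v = .aiDown ∨ F.η v = .aiUp) →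
      AIPath F ν (.ver v) (l₁ ++ [e]) →
      AIPath F (.ver v) ν' (e' :: l₂) →
      e ≠ e' →
      AIPath F ν ν' (l₁ ++ [e] ++ e' :: l₂)

/-- The flow contains an ai-cycle: an ai-path from a vertex to itself in
which no edge appears twice. -/
def HasAICycle (F : PreFlow) : Prop :=
  ∃ v l, v ∈ F.V ∧ AIPath F (.ver v) (.ver v) l ∧ l.Nodup

def CycleFree (F : PreFlow) : Prop := ¬ HasAICycle F

/-- An ai-connection: a path from an interaction vertex to a cointeraction
vertex or vice versa. -/
def IsConnection (F : PreFlow) (l : List ℕ) : Prop :=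
  ∃ v v', v ∈ F.V ∧ v' ∈ F.V ∧
    ((F.η v = .aiDown ∧ F.η v' = .aiUp) ∨
     (F.η v = .aiUp ∧ F.η v' = .aiDown)) ∧
    IsPath F (.ver v) (.ver v') l

/-- A simple edge: an ai-connection consisting of a single edge. -/
def SimpleEdge (F : PreFlow) (e : ℕ) : Prop := IsConnection F [e]

/-- A clean path: an ai-path all of whose ai-connections are simple edges. -/
def IsCleanPath (F : PreFlow) (ν ν' : VPt) (l : List ℕ) : Prop :=
  AIPath F ν ν' l ∧
  ∀ l₁ l₂ l₃, l = l₁ ++ l₂ ++ l₃ → IsConnection F l₂ → l₂.length = 1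

/-! ### Local flow reduction rules. -/

open PreFlow

/-- Rule `w↓-c↓`: a weakening feeding a contraction is erased, merging the
contraction's other two edges. -/
def RedWdCd (A B : PreFlow) : Prop :=
  ∃ v₁ v₂ e e₂ e₃,
    v₁ ∈ A.V ∧ v₂ ∈ A.V ∧ v₁ ≠ v₂ ∧
    A.η v₁ = .awDown ∧ A.η v₂ = .acDown ∧
    e ∈ A.E ∧ e₂ ∈ A.E ∧ e₃ ∈ A.E ∧ e ≠ e₂ ∧ e ≠ e₃ ∧ e₂ ≠ e₃ ∧
    A.up e = some v₁ ∧ A.lo e = some v₂ ∧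
    A.lo e₂ = some v₂ ∧ A.up e₃ = some v₂ ∧
    B.V = (A.V.erase v₁).erase v₂ ∧
    B.E = (A.E.erase e).erase e₃ ∧
    B.η = A.η ∧ B.up = A.up ∧
    B.lo = Function.update A.lo e₂ (A.lo e₃)

/-- Rule `c↑-w↑` (dual of `w↓-c↓`). -/
def RedCuWu (A B : PreFlow) : Prop :=
  ∃ v₁ v₂ e e₂ e₃,
    v₁ ∈ A.V ∧ v₂ ∈ A.V ∧ v₁ ≠ v₂ ∧
    A.η v₁ = .awUp ∧ A.η v₂ = .acUp ∧
    e ∈ A.E ∧ e₂ ∈ A.E ∧ e₃ ∈ A.E ∧ e ≠ e₂ ∧ e ≠ e₃ ∧ e₂ ≠ e₃ ∧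
    A.lo e = some v₁ ∧ A.up e = some v₂ ∧
    A.up e₂ = some v₂ ∧ A.lo e₃ = some v₂ ∧
    B.V = (A.V.erase v₁).erase v₂ ∧
    B.E = (A.E.erase e).erase e₃ ∧
    B.η = A.η ∧ B.lo = A.lo ∧
    B.up = Function.update A.up e₂ (A.up e₃)

/-- Rule `w↓-i↑`: a weakening feeding a cointeraction is replaced by a
coweakening on the other cointeraction edge. -/
def RedWdIu (A B : PreFlow) : Prop :=
  ∃ v₁ v₂ e e₂,
    v₁ ∈ A.V ∧ v₂ ∈ A.V ∧ v₁ ≠ v₂ ∧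
    A.η v₁ = .awDown ∧ A.η v₂ = .aiUp ∧
    e ∈ A.E ∧ e₂ ∈ A.E ∧ e ≠ e₂ ∧
    A.up e = some v₁ ∧ A.lo e = some v₂ ∧ A.lo e₂ = some v₂ ∧
    B.V = A.V.erase v₁ ∧ B.E = A.E.erase e ∧
    B.η = Function.update A.η v₂ .awUp ∧
    B.up = A.up ∧ B.lo = A.lo

/-- Rule `i↓-w↑` (dual of `w↓-i↑`). -/
def RedIdWu (A B : PreFlow) : Prop :=
  ∃ v₁ v₂ e e₂,
    v₁ ∈ A.V ∧ v₂ ∈ A.V ∧ v₁ ≠ v₂ ∧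
    A.η v₁ = .awUp ∧ A.η v₂ = .aiDown ∧
    e ∈ A.E ∧ e₂ ∈ A.E ∧ e ≠ e₂ ∧
    A.lo e = some v₁ ∧ A.up e = some v₂ ∧ A.up e₂ = some v₂ ∧
    B.V = A.V.erase v₁ ∧ B.E = A.E.erase e ∧
    B.η = Function.update A.η v₂ .awDown ∧
    B.up = A.up ∧ B.lo = A.lo

/-- Rule `w↓-w↑`: a weakening joined to a coweakening is erased. -/
def RedWdWu (A B : PreFlow) : Prop :=
  ∃ v₁ v₂ e,
    v₁ ∈ A.V ∧ v₂ ∈ A.V ∧ v₁ ≠ v₂ ∧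
    A.η v₁ = .awDown ∧ A.η v₂ = .awUp ∧
    e ∈ A.E ∧ A.up e = some v₁ ∧ A.lo e = some v₂ ∧
    B.V = (A.V.erase v₁).erase v₂ ∧ B.E = A.E.erase e ∧
    B.η = A.η ∧ B.up = A.up ∧ B.lo = A.lo

/-- Rule `w↓-c↑`: a weakening feeding a cocontraction is replaced by two
weakenings. -/
def RedWdCu (A B : PreFlow) : Prop :=
  ∃ v₁ v₂ e e₁ e₂,
    v₁ ∈ A.V ∧ v₂ ∈ A.V ∧ v₁ ≠ v₂ ∧
    A.η v₁ = .awDown ∧ A.η v₂ = .acUp ∧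
    e ∈ A.E ∧ e₁ ∈ A.E ∧ e₂ ∈ A.E ∧ e ≠ e₁ ∧ e ≠ e₂ ∧ e₁ ≠ e₂ ∧
    A.up e = some v₁ ∧ A.lo e = some v₂ ∧
    A.up e₁ = some v₂ ∧ A.up e₂ = some v₂ ∧
    B.V = A.V ∧ B.E = A.E.erase e ∧
    B.η = Function.update A.η v₂ .awDown ∧
    B.up = Function.update A.up e₁ (some v₁) ∧
    B.lo = A.lo

/-- Rule `c↓-w↑` (dual of `w↓-c↑`). -/
def RedCdWu (A B : PreFlow) : Prop :=
  ∃ v₁ v₂ e e₁ e₂,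
    v₁ ∈ A.V ∧ v₂ ∈ A.V ∧ v₁ ≠ v₂ ∧
    A.η v₁ = .awUp ∧ A.η v₂ = .acDown ∧
    e ∈ A.E ∧ e₁ ∈ A.E ∧ e₂ ∈ A.E ∧ e ≠ e₁ ∧ e ≠ e₂ ∧ e₁ ≠ e₂ ∧
    A.lo e = some v₁ ∧ A.up e = some v₂ ∧
    A.lo e₁ = some v₂ ∧ A.lo e₂ = some v₂ ∧
    B.V = A.V ∧ B.E = A.E.erase e ∧
    B.η = Function.update A.η v₂ .awUp ∧
    B.lo = Function.update A.lo e₁ (some v₁) ∧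
    B.up = A.up

/-- Rule `c↓-i↑`: a contraction whose output edge enters a cointeraction is
replaced by a cocontraction on the other cointeraction edge followed by two
cointeractions. -/
def RedCdIu (A B : PreFlow) : Prop :=
  ∃ v₁ v₂ v₃ e e₁ e₂ e₃ g₁ g₂,
    v₁ ∈ A.V ∧ v₂ ∈ A.V ∧ v₁ ≠ v₂ ∧ v₃ ∉ A.V ∧
    A.η v₁ = .acDown ∧ A.η v₂ = .aiUp ∧
    e ∈ A.E ∧ e₁ ∈ A.E ∧ e₂ ∈ A.E ∧ e₃ ∈ A.E ∧
    e ≠ e₁ ∧ e ≠ e₂ ∧ e ≠ e₃ ∧ e₁ ≠ e₂ ∧ e₁ ≠ e₃ ∧ e₂ ≠ e₃ ∧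
    g₁ ∉ A.E ∧ g₂ ∉ A.E ∧ g₁ ≠ g₂ ∧
    A.lo e₁ = some v₁ ∧ A.lo e₂ = some v₁ ∧
    A.up e = some v₁ ∧ A.lo e = some v₂ ∧ A.lo e₃ = some v₂ ∧
    B.V = insert v₃ A.V ∧
    B.E = insert g₁ (insert g₂ (A.E.erase e)) ∧
    B.η = Function.update (Function.update A.η v₁ .acUp) v₃ .aiUp ∧
    B.up = Function.update (Function.update A.up g₁ (some v₁)) g₂ (some v₁) ∧
    B.lo = Function.update (Function.update (Function.update
      (Function.update (Function.update A.lo e₁ (some v₂)) e₂ (some v₃))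
        e₃ (some v₁)) g₁ (some v₂)) g₂ (some v₃)

/-- Rule `i↓-c↑` (dual of `c↓-i↑`). -/
def RedIdCu (A B : PreFlow) : Prop :=
  ∃ v₁ v₂ v₃ e e₁ e₂ e₃ g₁ g₂,
    v₁ ∈ A.V ∧ v₂ ∈ A.V ∧ v₁ ≠ v₂ ∧ v₃ ∉ A.V ∧
    A.η v₁ = .acUp ∧ A.η v₂ = .aiDown ∧
    e ∈ A.E ∧ e₁ ∈ A.E ∧ e₂ ∈ A.E ∧ e₃ ∈ A.E ∧
    e ≠ e₁ ∧ e ≠ e₂ ∧ e ≠ e₃ ∧ e₁ ≠ e₂ ∧ e₁ ≠ e₃ ∧ e₂ ≠ e₃ ∧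
    g₁ ∉ A.E ∧ g₂ ∉ A.E ∧ g₁ ≠ g₂ ∧
    A.up e₁ = some v₁ ∧ A.up e₂ = some v₁ ∧
    A.lo e = some v₁ ∧ A.up e = some v₂ ∧ A.up e₃ = some v₂ ∧
    B.V = insert v₃ A.V ∧
    B.E = insert g₁ (insert g₂ (A.E.erase e)) ∧
    B.η = Function.update (Function.update A.η v₁ .acDown) v₃ .aiDown ∧
    B.lo = Function.update (Function.update A.lo g₁ (some v₁)) g₂ (some v₁) ∧
    B.up = Function.update (Function.update (Function.update
      (Function.update (Function.update A.up e₁ (some v₂)) e₂ (some v₃))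
        e₃ (some v₁)) g₁ (some v₂)) g₂ (some v₃)

/-- Rule `c↓-c↑`: a contraction whose output enters a cocontraction is
replaced by two cocontractions above two contractions, crosswise connected. -/
def RedCdCu (A B : PreFlow) : Prop :=
  ∃ v₁ v₂ v₃ v₄ e e₁ e₂ e₃ e₄ g₁₁ g₁₂ g₂₁ g₂₂,
    v₁ ∈ A.V ∧ v₂ ∈ A.V ∧ v₁ ≠ v₂ ∧
    v₃ ∉ A.V ∧ v₄ ∉ A.V ∧ v₃ ≠ v₄ ∧
    A.η v₁ = .acDown ∧ A.η v₂ = .acUp ∧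
    e ∈ A.E ∧ e₁ ∈ A.E ∧ e₂ ∈ A.E ∧ e₃ ∈ A.E ∧ e₄ ∈ A.E ∧
    e ≠ e₁ ∧ e ≠ e₂ ∧ e ≠ e₃ ∧ e ≠ e₄ ∧
    e₁ ≠ e₂ ∧ e₁ ≠ e₃ ∧ e₁ ≠ e₄ ∧ e₂ ≠ e₃ ∧ e₂ ≠ e₄ ∧ e₃ ≠ e₄ ∧
    g₁₁ ∉ A.E ∧ g₁₂ ∉ A.E ∧ g₂₁ ∉ A.E ∧ g₂₂ ∉ A.E ∧
    g₁₁ ≠ g₁₂ ∧ g₁₁ ≠ g₂₁ ∧ g₁₁ ≠ g₂₂ ∧ g₁₂ ≠ g₂₁ ∧ g₁₂ ≠ g₂₂ ∧ g₂₁ ≠ g₂₂ ∧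
    A.lo e₁ = some v₁ ∧ A.lo e₂ = some v₁ ∧ A.up e = some v₁ ∧
    A.lo e = some v₂ ∧ A.up e₃ = some v₂ ∧ A.up e₄ = some v₂ ∧
    B.V = insert v₃ (insert v₄ A.V) ∧
    B.E = insert g₁₁ (insert g₁₂ (insert g₂₁ (insert g₂₂ (A.E.erase e)))) ∧
    B.η = Function.update (Function.update (Function.update
      (Function.update A.η v₁ .acUp) v₂ .acUp) v₃ .acDown) v₄ .acDown ∧
    B.up = Function.update (Function.update (Function.update
      (Function.update (Function.update (Function.update A.up
        e₃ (some v₃)) e₄ (some v₄)) g₁₁ (some v₁)) g₁₂ (some v₁))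
          g₂₁ (some v₂)) g₂₂ (some v₂) ∧
    B.lo = Function.update (Function.update (Function.update
      (Function.update (Function.update A.lo e₂ (some v₂)) g₁₁ (some v₃))
        g₁₂ (some v₄)) g₂₁ (some v₃)) g₂₂ (some v₄)

/-- One step of the flow rewriting system `w`. -/
def StepW (A B : PreFlow) : Prop :=
  RedWdCd A B ∨ RedCuWu A B ∨ RedWdIu A B ∨ RedIdWu A B ∨
  RedWdWu A B ∨ RedWdCu A B ∨ RedCdWu A B

/-- One step of the flow rewriting system `c`. -/
def StepC (A B : PreFlow) : Prop :=
  RedCdIu A B ∨ RedIdCu A B ∨ RedCdCu A B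

/-- `A` is normal for the flow rewriting system `w`. -/
def NormalW (A : PreFlow) : Prop := ¬ ∃ B, StepW A B

/-- `A` is normal for the flow rewriting system `c`. -/
def NormalC (A : PreFlow) : Prop := ¬ ∃ B, StepC A B

/-! ### Flow isomorphisms. -/

structure FlowIso (A B : PreFlow) : Type where
  vmap : ℕ → ℕ
  emap : ℕ → ℕ
  vbij : Set.BijOn vmap (A.V : Set ℕ) (B.V : Set ℕ)
  ebij : Set.BijOn emap (A.E : Set ℕ) (B.E : Set ℕ)
  lab : ∀ v ∈ A.V, B.η (vmap v) = A.η v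
  upc : ∀ e ∈ A.E, B.up (emap e) = (A.up e).map vmap
  loc : ∀ e ∈ A.E, B.lo (emap e) = (A.lo e).map vmap

/-! ### The global reduction `→se` (elimination of a simple edge). -/

/-- The flow obtained from `B` by eliminating the simple edge `e0` between
the interaction `vi` and the cointeraction `vc` (with `e2` the other lower
edge of `vi` and `e3` the other upper edge of `vc`): two copies (tags `0`,
hat, the lower one, and `1`, tilde, the upper one) of the remaining flow are
glued by identifying the hat copy of `e2` with the tilde copy of `e3`; a
weakening (vertex `(2,0)`) is placed above the tilde copy of `e2`, a
coweakening (vertex `(2,1)`) below the hat copy of `e3`; each upper edge `ε`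
of `B` gives a cocontraction (vertex `(3,ε)`, with a new upper edge `(3,ε)`)
joining the two copies of `ε`, and dually each lower edge `ε'` of `B` gives
a contraction (vertex `(4,ε')`, with a new lower edge `(4,ε')`). -/
def seFlow (B : PreFlow) (vi vc e0 e2 e3 : ℕ) : PreFlow :=
  { V := ((B.V.erase vi).erase vc).image (Nat.pair 0) ∪
         ((B.V.erase vi).erase vc).image (Nat.pair 1) ∪
         {Nat.pair 2 0, Nat.pair 2 1} ∪
         (B.E.filter (fun e => B.up e = none)).image (Nat.pair 3) ∪
         (B.E.filter (fun e => B.lo e = none)).image (Nat.pair 4),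
    E := (B.E.erase e0).image (Nat.pair 0) ∪
         (B.E.erase e0).image (fun e => if e = e3 then Nat.pair 0 e2 else Nat.pair 1 e) ∪
         (B.E.filter (fun e => B.up e = none)).image (Nat.pair 3) ∪
         (B.E.filter (fun e => B.lo e = none)).image (Nat.pair 4),
    η := fun x =>
      if (Nat.unpair x).1 = 2 then
        (if (Nat.unpair x).2 = 0 then FlowLabel.awDown else FlowLabel.awUp)
      else if (Nat.unpair x).1 = 3 then FlowLabel.acUp
      else if (Nat.unpair x).1 = 4 then FlowLabel.acDown
      else B.η (Nat.unpair x).2,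
    up := fun x =>
      let t := (Nat.unpair x).1
      let y := (Nat.unpair x).2
      if t = 0 then
        (if y = e2 then
          (match B.up e3 with
           | some v => some (Nat.pair 1 v)
           | none => some (Nat.pair 3 e3))
        else
          (match B.up y with
           | some v => some (Nat.pair 0 v)
           | none => some (Nat.pair 3 y)))
      else if t = 1 then
        (if y = e2 then some (Nat.pair 2 0)
        else
          (match B.up y with
           | some v => some (Nat.pair 1 v)
           | none => some (Nat.pair 3 y)))
      else if t = 3 then none
      else some (Nat.pair 4 y),
    lo := fun x =>
      let t := (Nat.unpair x).1
      let y := (Nat.unpair x).2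
      if t = 0 then
        (if y = e2 then
          (match B.lo e2 with
           | some v => some (Nat.pair 0 v)
           | none => some (Nat.pair 4 e2))
        else if y = e3 then some (Nat.pair 2 1)
        else
          (match B.lo y with
           | some v => some (Nat.pair 0 v)
           | none => some (Nat.pair 4 y)))
      else if t = 1 then
        (match B.lo y with
         | some v => some (Nat.pair 1 v)
         | none => some (Nat.pair 4 y))
      else if t = 3 then some (Nat.pair 3 y)
      else none }

/-- The reduction `→se`: elimination of a simple edge (up to flow
isomorphism). -/
def RedSE (B C : PreFlow) : Prop :=
  ∃ vi vc e0 e2 e3,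
    vi ∈ B.V ∧ vc ∈ B.V ∧ vi ≠ vc ∧
    B.η vi = .aiDown ∧ B.η vc = .aiUp ∧
    e0 ∈ B.E ∧ e2 ∈ B.E ∧ e3 ∈ B.E ∧
    e0 ≠ e2 ∧ e0 ≠ e3 ∧ e2 ≠ e3 ∧
    B.up e0 = some vi ∧ B.lo e0 = some vc ∧
    B.up e2 = some vi ∧ B.lo e3 = some vc ∧
    Nonempty (FlowIso C (seFlow B vi vc e0 e2 e3))

/-! ### The atomic flow associated with a derivation. -/

/-- Correspondence conditions for a linear rule applied at position `q`:
for each pair `(c₁, c₂)` in `cs`, occurrences at `q ++ c₁ ++ p` in the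
conclusion (formula `i+1`) are traced to occurrences at `q ++ c₂ ++ p` in
the premiss (formula `i`). -/
def corrCond (f : ℕ → List Bool → ℕ) (i : ℕ) (q : List Bool) (ψ : Formula)
    (cs : List (List Bool × List Bool)) : Prop :=
  ∀ c ∈ cs, ∀ p : List Bool, ψ.IsOcc (q ++ c.1 ++ p) →
    f (i + 1) (q ++ c.1 ++ p) = f i (q ++ c.2 ++ p)

/-- The tracing conditions for one inference step: occurrences in the
context are traced to the same edge, and the active occurrences of a
structural rule are related to the edges of the vertex `v` as prescribed by
its label, while the active occurrences of logical and `=` steps are traced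
to the same edges under the canonical correspondence. -/
def stepCond (A : PreFlow) (f : ℕ → List Bool → ℕ) (v : ℕ) (i : ℕ)
    (r : RuleName) (q : List Bool) (φ ψ : Formula) : Prop :=
  (∀ p, ¬ (q <+: p) → φ.IsOcc p → f (i + 1) p = f i p) ∧
  match r with
  | .aiDown =>
      A.η v = .aiDown ∧
      A.up (f (i + 1) (q ++ [false])) = some v ∧
      A.up (f (i + 1) (q ++ [true])) = some v ∧
      f (i + 1) (q ++ [false]) ≠ f (i + 1) (q ++ [true])
  | .aiUp =>
      A.η v = .aiUp ∧
      A.lo (f i (q ++ [false])) = some v ∧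
      A.lo (f i (q ++ [true])) = some v ∧
      f i (q ++ [false]) ≠ f i (q ++ [true])
  | .awDown => A.η v = .awDown ∧ A.up (f (i + 1) q) = some v
  | .awUp => A.η v = .awUp ∧ A.lo (f i q) = some v
  | .acDown =>
      A.η v = .acDown ∧
      A.lo (f i (q ++ [false])) = some v ∧
      A.lo (f i (q ++ [true])) = some v ∧
      A.up (f (i + 1) q) = some v ∧
      f i (q ++ [false]) ≠ f i (q ++ [true])
  | .acUp =>
      A.η v = .acUp ∧
      A.lo (f i q) = some v ∧
      A.up (f (i + 1) (q ++ [false])) = some v ∧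
      A.up (f (i + 1) (q ++ [true])) = some v ∧
      f (i + 1) (q ++ [false]) ≠ f (i + 1) (q ++ [true])
  | .s => corrCond f i q ψ
      [([false, false], [false]), ([false, true], [true, false]),
       ([true], [true, true])]
  | .m => corrCond f i q ψ
      [([false, false], [false, false]), ([true, false], [false, true]),
       ([false, true], [true, false]), ([true, true], [true, true])]
  | .eqOrComm => corrCond f i q ψ [([false], [true]), ([true], [false])]
  | .eqAndComm => corrCond f i q ψ [([false], [true]), ([true], [false])]
  | .eqOrAssocL => corrCond f i q ψ
      [([false], [false, false]), ([true, false], [false, true]),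
       ([true, true], [true])]
  | .eqOrAssocR => corrCond f i q ψ
      [([false, false], [false]), ([false, true], [true, false]),
       ([true], [true, true])]
  | .eqAndAssocL => corrCond f i q ψ
      [([false], [false, false]), ([true, false], [false, true]),
       ([true, true], [true])]
  | .eqAndAssocR => corrCond f i q ψ
      [([false, false], [false]), ([false, true], [true, false]),
       ([true], [true, true])]
  | .eqOrUnitDel => corrCond f i q ψ [([], [false])]
  | .eqOrUnitAdd => corrCond f i q ψ [([false], [])]
  | .eqAndUnitDel => corrCond f i q ψ [([], [false])]
  | .eqAndUnitAdd => corrCond f i q ψ [([false], [])]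
  | .eqTTDel => True
  | .eqTTAdd => True
  | .eqFFDel => True
  | .eqFFAdd => True

/-- `A` is the atomic flow associated with the derivation `Φ`, where `f`
maps each atom occurrence (formula index, position) of `Φ` to an edge of
`A`, and `g` assigns to each structural inference step its vertex. -/
def IsAssocFlow (Φ : Deriv) (A : PreFlow) (f : ℕ → List Bool → ℕ)
    (g : ℕ → ℕ) : Prop :=
  Φ.WF ∧ A.IsFlow ∧
  (∀ i p, i < Φ.nf → (Φ.fml i).IsOcc p → f i p ∈ A.E) ∧
  (∀ e ∈ A.E, ∃ i p, i < Φ.nf ∧ (Φ.fml i).IsOcc p ∧ f i p = e) ∧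
  (∀ i p p', i < Φ.nf → (Φ.fml i).IsOcc p → (Φ.fml i).IsOcc p' →
    f i p = f i p' → p = p') ∧
  (∀ p, (Φ.fml 0).IsOcc p → A.up (f 0 p) = none) ∧
  (∀ p, (Φ.fml Φ.steps.length).IsOcc p → A.lo (f Φ.steps.length p) = none) ∧
  (∀ i, i < Φ.steps.length → (Φ.stepAt i).1.isStructural = true → g i ∈ A.V) ∧
  (∀ v ∈ A.V, ∃ i, i < Φ.steps.length ∧
    (Φ.stepAt i).1.isStructural = true ∧ g i = v) ∧
  (∀ i j, i < Φ.steps.length → j < Φ.steps.length →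
    (Φ.stepAt i).1.isStructural = true → (Φ.stepAt j).1.isStructural = true →
    g i = g j → i = j) ∧
  (∀ i, i < Φ.steps.length →
    stepCond A f (g i) i (Φ.stepAt i).1 (Φ.stepAt i).2.1
      (Φ.fml i) (Φ.fml (i + 1)))

/-! ### Streamlining. -/

/-- No path from an interaction or weakening vertex to a cointeraction or
coweakening vertex. -/
def NoIWPath (A : PreFlow) : Prop :=
  ¬ ∃ v v' l, v ∈ A.V ∧ v' ∈ A.V ∧
      (A.η v = .aiDown ∨ A.η v = .awDown) ∧
      (A.η v' = .aiUp ∨ A.η v' = .awUp) ∧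
      IsPath A (.ver v) (.ver v') l

/-- `Φ` is a streamlined derivation. -/
def Streamlined (Φ : Deriv) : Prop :=
  ∃ A f g, IsAssocFlow Φ A f g ∧ NoIWPath A

/-- `Φ` is a super-streamlined derivation. -/
def SuperStreamlined (Φ : Deriv) : Prop :=
  ∃ A f g, IsAssocFlow Φ A f g ∧ NoIWPath A ∧ NormalW A

/-- `Φ` is a hyper-streamlined derivation. -/
def HyperStreamlined (Φ : Deriv) : Prop :=
  ∃ A f g, IsAssocFlow Φ A f g ∧ NoIWPath A ∧ NormalW A ∧ NormalC A

end AF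

namespace AF

/-! ### Semantics and soundness. -/

namespace Formula

/-- Truth of a formula under a valuation of the atoms. -/
def Holds (v : ℕ → Bool) : Formula → Prop
  | .tt => True
  | .ff => False
  | .atom n b => v n = b
  | .or α β => Holds v α ∨ Holds v β
  | .and α β => Holds v α ∧ Holds v β

/-- Semantic consequence. -/
def Entails (α β : Formula) : Prop := ∀ v, α.Holds v → β.Holds v

theorem Holds.repl_mono {v : ℕ → Bool} {γ δ : Formula} (h : γ.Holds v → δ.Holds v) :
    ∀ {q : List Bool} {φ : Formula}, φ.sub q = some γ → φ.Holds v → (φ.repl q δ).Holds v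
  | [], φ, hs, hφ => by
    cases φ <;> simp_all [sub, repl]
  | d :: q, φ, hs, hφ => by
    cases φ <;> cases d <;> simp only [sub, repl, Holds, reduceCtorEq] at hs hφ ⊢
    · exact hφ.imp_left (repl_mono h hs)
    · exact hφ.imp_right (repl_mono h hs)
    · exact hφ.imp_left (repl_mono h hs)
    · exact hφ.imp_right (repl_mono h hs)

/-- De Morgan dual. -/
def dual : Formula → Formula
  | .tt => .ff
  | .ff => .tt
  | .atom n b => .atom n (!b)
  | .or α β => .and (dual α) (dual β)
  | .and α β => .or (dual α) (dual β)

@[simp] theorem dual_dual (φ : Formula) : φ.dual.dual = φ := by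
  induction φ <;> simp_all [dual]

theorem holds_dual (v : ℕ → Bool) (φ : Formula) : φ.dual.Holds v ↔ ¬ φ.Holds v := by
  induction φ <;> simp_all [dual, Holds]
  · rename_i n b; cases v n <;> cases b <;> simp
  · tauto

theorem Entails.dual {α β : Formula} (h : Entails α β) : Entails β.dual α.dual := by
  intro v hv
  rw [holds_dual] at hv ⊢
  exact fun hα => hv (h v hα)

end Formula

open Formula

theorem RuleInstance.sound {r : RuleName} {γ δ : Formula} (h : RuleInstance r γ δ) :
    Entails γ δ := by
  intro v
  cases h <;> simp only [Holds] <;> try tauto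
  all_goals rename_i n b; cases v n <;> cases b <;> simp

theorem Deriv.WF.entails {Φ : Deriv} (h : Φ.WF) : Entails Φ.prem Φ.concl := by
  intro v hv
  have key : ∀ i, i ≤ Φ.steps.length → (Φ.fml i).Holds v := by
    intro i
    induction i with
    | zero => intro _; simpa [Deriv.fml] using hv
    | succ i ih =>
      intro hi
      obtain ⟨γ, δ, hs, hr, he⟩ := h i hi
      rw [he]
      exact Holds.repl_mono (hr.sound v) hs (ih (by omega))
  exact key _ le_rfl

/-! ### Closure properties of derivability. -/

theorem StepAt.cons {r : RuleName} {q : List Bool} {φ ψ : Formula} (h : StepAt r q φ ψ)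
    (χ : Formula) :
    StepAt r (false :: q) (.or φ χ) (.or ψ χ) ∧ StepAt r (true :: q) (.or χ φ) (.or χ ψ) ∧
    StepAt r (false :: q) (.and φ χ) (.and ψ χ) ∧ StepAt r (true :: q) (.and χ φ) (.and χ ψ) := by
  obtain ⟨γ, δ, hs, hr, rfl⟩ := h
  exact ⟨⟨γ, δ, hs, hr, rfl⟩, ⟨γ, δ, hs, hr, rfl⟩, ⟨γ, δ, hs, hr, rfl⟩, ⟨γ, δ, hs, hr, rfl⟩⟩

theorem RuleInstance.stepAt {r : RuleName} {γ δ : Formula} (h : RuleInstance r γ δ) :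
    StepAt r [] γ δ :=
  ⟨γ, δ, by cases γ <;> rfl, h, by cases γ <;> rfl⟩

/-- A step is either at the root or inside an immediate subformula. -/
theorem StepAt.cases {r : RuleName} {q : List Bool} {φ ψ : Formula} (h : StepAt r q φ ψ) :
    (q = [] ∧ RuleInstance r φ ψ) ∨
    ∃ q' φ' ψ' χ, StepAt r q' φ' ψ' ∧ q'.length < q.length ∧
      ((φ = .or φ' χ ∧ ψ = .or ψ' χ) ∨ (φ = .or χ φ' ∧ ψ = .or χ ψ') ∨
       (φ = .and φ' χ ∧ ψ = .and ψ' χ) ∨ (φ = .and χ φ' ∧ ψ = .and χ ψ')) := by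
  obtain ⟨γ, δ, hs, hr, rfl⟩ := h
  cases q with
  | nil =>
    left
    cases φ <;> simp_all [sub, repl]
  | cons d q =>
    right
    cases φ <;> cases d <;> simp only [sub, repl, reduceCtorEq] at hs ⊢
    · exact ⟨q, _, _, _, ⟨γ, δ, hs, hr, rfl⟩, by simp, .inl ⟨rfl, rfl⟩⟩
    · exact ⟨q, _, _, _, ⟨γ, δ, hs, hr, rfl⟩, by simp, .inr (.inl ⟨rfl, rfl⟩)⟩
    · exact ⟨q, _, _, _, ⟨γ, δ, hs, hr, rfl⟩, by simp, .inr (.inr (.inl ⟨rfl, rfl⟩))⟩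
    · exact ⟨q, _, _, _, ⟨γ, δ, hs, hr, rfl⟩, by simp, .inr (.inr (.inr ⟨rfl, rfl⟩))⟩

/-- Induction principle for steps: root instances, then contexts. -/
theorem Step.rec_context {S : Set RuleName} {P : Formula → Formula → Prop}
    (root : ∀ r ∈ S, ∀ φ ψ, RuleInstance r φ ψ → P φ ψ)
    (orL : ∀ φ ψ χ, P φ ψ → P (.or φ χ) (.or ψ χ))
    (orR : ∀ φ ψ χ, P φ ψ → P (.or χ φ) (.or χ ψ))
    (andL : ∀ φ ψ χ, P φ ψ → P (.and φ χ) (.and ψ χ))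
    (andR : ∀ φ ψ χ, P φ ψ → P (.and χ φ) (.and χ ψ))
    {φ ψ : Formula} (h : Step S φ ψ) : P φ ψ := by
  obtain ⟨r, hr, q, hq⟩ := h
  induction hn : q.length using Nat.strong_induction_on generalizing q φ ψ with
  | _ n ih =>
    subst hn
    rcases hq.cases with ⟨_, h⟩ | ⟨q', φ', ψ', χ, h, hl, hc⟩
    · exact root r hr _ _ h
    · have := ih _ hl q' h rfl
      rcases hc with ⟨rfl, rfl⟩ | ⟨rfl, rfl⟩ | ⟨rfl, rfl⟩ | ⟨rfl, rfl⟩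
      · exact orL _ _ _ this
      · exact orR _ _ _ this
      · exact andL _ _ _ this
      · exact andR _ _ _ this

namespace Derives

variable {S T : Set RuleName} {α β γ δ α' β' : Formula}

theorem refl (α : Formula) : Derives S α α := Relation.ReflTransGen.refl

theorem trans (h : Derives S α β) (h' : Derives S β γ) : Derives S α γ :=
  Relation.ReflTransGen.trans h h'

theorem of_rule {r : RuleName} (h : RuleInstance r α β) (hr : r ∈ S) : Derives S α β :=
  Relation.ReflTransGen.single ⟨r, hr, [], h.stepAt⟩

theorem or_left (γ : Formula) (h : Derives S α β) : Derives S (.or α γ) (.or β γ) :=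
  Relation.ReflTransGen.lift (fun x => Formula.or x γ)
    (fun _ _ ⟨r, hr, _, hq⟩ => ⟨r, hr, _, (hq.cons γ).1⟩) _ _ h

theorem or_right (γ : Formula) (h : Derives S α β) : Derives S (.or γ α) (.or γ β) :=
  Relation.ReflTransGen.lift (fun x => Formula.or γ x)
    (fun _ _ ⟨r, hr, _, hq⟩ => ⟨r, hr, _, (hq.cons γ).2.1⟩) _ _ h

theorem and_left (γ : Formula) (h : Derives S α β) : Derives S (.and α γ) (.and β γ) :=
  Relation.ReflTransGen.lift (fun x => Formula.and x γ)
    (fun _ _ ⟨r, hr, _, hq⟩ => ⟨r, hr, _, (hq.cons γ).2.2.1⟩) _ _ h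

theorem and_right (γ : Formula) (h : Derives S α β) : Derives S (.and γ α) (.and γ β) :=
  Relation.ReflTransGen.lift (fun x => Formula.and γ x)
    (fun _ _ ⟨r, hr, _, hq⟩ => ⟨r, hr, _, (hq.cons γ).2.2.2⟩) _ _ h

theorem or_congr (h : Derives S α α') (h' : Derives S β β') :
    Derives S (.or α β) (.or α' β') :=
  (h.or_left β).trans (h'.or_right α')

theorem and_congr (h : Derives S α α') (h' : Derives S β β') :
    Derives S (.and α β) (.and α' β') :=
  (h.and_left β).trans (h'.and_right α')

end Derives

/-- The linear logical rules together with the given structural rules. -/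
def linearWith (T : Set RuleName) : Set RuleName := {r | r.isStructural = false} ∪ T

theorem mem_linearWith {T : Set RuleName} {r : RuleName} (h : r.isStructural = false) :
    r ∈ linearWith T := Or.inl h

namespace Derives

variable {T : Set RuleName} (α β γ δ : Formula)

theorem linear {r : RuleName} {α β : Formula} (h : RuleInstance r α β)
    (hr : r.isStructural = false := by rfl) : Derives (linearWith T) α β :=
  of_rule h (mem_linearWith hr)

theorem ff_tt : Derives (linearWith T) .ff .tt :=
  (linear (.eqAndUnitAdd _)).trans <| ((linear .eqTTAdd).and_right _).trans <|
  (linear (.s _ _ _)).trans <| ((linear (.eqAndUnitDel _)).or_left _).trans <|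
  (linear (.eqOrComm _ _)).trans <| linear (.eqOrUnitDel _)

theorem coweakening (h : RuleName.awUp ∈ T) : Derives (linearWith T) α .tt := by
  induction α with
  | tt => exact refl _
  | ff => exact ff_tt
  | atom n b => exact of_rule (.awUp n b) (Or.inr h)
  | or α β ihα ihβ => exact (or_congr ihα ihβ).trans (linear .eqTTDel)
  | and α β ihα ihβ => exact (and_congr ihα ihβ).trans (linear (.eqAndUnitDel _))

theorem and_swap_mid :
    Derives (linearWith T) (.and (.and α β) (.and γ δ)) (.and (.and α γ) (.and β δ)) :=
  (linear (.eqAndAssocL _ _ _)).trans <|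
  ((linear (.eqAndAssocR _ _ _)).trans <|
    ((linear (.eqAndComm _ _)).and_left _).trans (linear (.eqAndAssocL _ _ _))).and_right _
  |>.trans (linear (.eqAndAssocR _ _ _))

theorem cocontraction (h : RuleName.acUp ∈ T) : Derives (linearWith T) α (.and α α) := by
  induction α with
  | tt => exact linear (.eqAndUnitAdd _)
  | ff => exact linear .eqFFAdd
  | atom n b => exact of_rule (.acUp n b) (Or.inr h)
  | or α β ihα ihβ => exact (or_congr ihα ihβ).trans (linear (.m _ _ _ _))
  | and α β ihα ihβ => exact (and_congr ihα ihβ).trans (and_swap_mid _ _ _ _)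

theorem distrib (h : RuleName.acUp ∈ T) :
    Derives (linearWith T) (.and (.or α β) γ) (.or (.and α γ) (.and β γ)) :=
  ((cocontraction γ h).and_right _).trans <|
  (linear (.eqAndAssocR _ _ _)).trans <|
  (((linear (.eqAndComm _ _)).trans <| (linear (.s _ _ _)).trans
    ((linear (.eqAndComm _ _)).or_left _)).and_left _).trans <|
  (linear (.eqAndComm _ _)).trans <|
  ((linear (.eqOrComm _ _)).and_right _).trans <|
  (linear (.s _ _ _)).trans <|
  (linear (.eqOrComm _ _)).trans <|
  (linear (.eqAndComm _ _)).or_right _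

end Derives

/-- The structural rule dual to a given one; linear rules are left alone. -/
def RuleName.dual : RuleName → RuleName
  | .aiDown => .aiUp
  | .aiUp => .aiDown
  | .awDown => .awUp
  | .awUp => .awDown
  | .acDown => .acUp
  | .acUp => .acDown
  | r => r

theorem RuleInstance.dual {T : Set RuleName} {r : RuleName} {α β : Formula}
    (h : RuleInstance r α β) (hT : r.dual ∈ linearWith T) :
    Derives (linearWith T) β.dual α.dual := by
  cases h with
  | aiDown n b => exact .of_rule (.aiUp n (!b)) hT
  | aiUp n b => exact .of_rule (.aiDown n (!b)) hT
  | awDown n b => exact .of_rule (.awUp n (!b)) hT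
  | awUp n b => exact .of_rule (.awDown n (!b)) hT
  | acDown n b => exact .of_rule (.acUp n (!b)) hT
  | acUp n b => exact .of_rule (.acDown n (!b)) hT
  | s α β γ =>
    exact (Derives.linear (.eqAndComm _ _)).trans <|
      ((Derives.linear (.eqOrComm _ _)).and_right _).trans <|
      (Derives.linear (.s _ _ _)).trans <| (Derives.linear (.eqOrComm _ _)).trans <|
      (Derives.linear (.eqAndComm _ _)).or_right _
  | m α β γ δ => exact .linear (.m _ _ _ _)
  | eqOrComm α β => exact .linear (.eqAndComm _ _)
  | eqAndComm α β => exact .linear (.eqOrComm _ _)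
  | eqOrAssocL α β γ => exact .linear (.eqAndAssocR _ _ _)
  | eqOrAssocR α β γ => exact .linear (.eqAndAssocL _ _ _)
  | eqAndAssocL α β γ => exact .linear (.eqOrAssocR _ _ _)
  | eqAndAssocR α β γ => exact .linear (.eqOrAssocL _ _ _)
  | eqOrUnitDel α => exact .linear (.eqAndUnitAdd _)
  | eqOrUnitAdd α => exact .linear (.eqAndUnitDel _)
  | eqAndUnitDel α => exact .linear (.eqOrUnitAdd _)
  | eqAndUnitAdd α => exact .linear (.eqOrUnitDel _)
  | eqTTDel => exact .linear .eqFFAdd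
  | eqTTAdd => exact .linear .eqFFDel
  | eqFFDel => exact .linear .eqTTAdd
  | eqFFAdd => exact .linear .eqTTDel

theorem Derives.dual {S T : Set RuleName} {α β : Formula} (h : Derives S α β)
    (hST : ∀ r ∈ S, r.dual ∈ linearWith T) : Derives (linearWith T) β.dual α.dual := by
  induction h with
  | refl => exact .refl _
  | tail _ hs ih =>
    refine Derives.trans ?_ ih
    refine Step.rec_context (P := fun φ ψ => Derives (linearWith T) ψ.dual φ.dual)
      ?_ ?_ ?_ ?_ ?_ hs
    · exact fun r hr φ ψ h => h.dual (hST r hr)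
    · exact fun φ ψ χ h => h.and_left _
    · exact fun φ ψ χ h => h.and_right _
    · exact fun φ ψ χ h => h.or_left _
    · exact fun φ ψ χ h => h.or_right _

/-! ### Interpolation: going up-fragment first, down-fragment second. -/

/-- The up-fragment: coweakening, cocontraction and cointeraction. -/
abbrev upRules : Set RuleName := linearWith {.awUp, .acUp, .aiUp}

/-- The down-fragment: interaction, contraction and weakening. -/
abbrev downRules : Set RuleName := linearWith {.awDown, .acDown, .aiDown}

theorem upRules_dual {r : RuleName} (h : r ∈ upRules) : r.dual ∈ downRules := by
  rcases h with h | h | h | h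
  · left; cases r <;> simp_all [RuleName.isStructural, RuleName.dual]
  all_goals subst h; simp [downRules, linearWith, RuleName.dual]

theorem downRules_dual {r : RuleName} (h : r ∈ downRules) : r.dual ∈ upRules := by
  rcases h with h | h | h | h
  · left; cases r <;> simp_all [RuleName.isStructural, RuleName.dual]
  all_goals subst h; simp [upRules, linearWith, RuleName.dual]

/-- `β` is reached from `α` through an interpolant. -/
def UpDown (α β : Formula) : Prop := ∃ γ, Derives upRules α γ ∧ Derives downRules γ β

namespace UpDown

variable {α β γ α' β' : Formula}

theorem dual (h : UpDown α β) : UpDown β.dual α.dual := by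
  obtain ⟨γ, h₁, h₂⟩ := h
  exact ⟨γ.dual, h₂.dual fun _ => downRules_dual, h₁.dual fun _ => upRules_dual⟩

theorem up_trans (h : Derives upRules α α') (h' : UpDown α' β) : UpDown α β :=
  let ⟨γ, h₁, h₂⟩ := h'
  ⟨γ, h.trans h₁, h₂⟩

end UpDown

theorem Derives.down_of_up {α β : Formula} (h : Derives upRules α.dual β.dual) :
    Derives downRules β α := by
  simpa using h.dual (T := {.awDown, .acDown, .aiDown}) fun _ => upRules_dual

theorem up_coweakening (α : Formula) : Derives upRules α .tt := Derives.coweakening α (by simp)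

theorem up_cocontraction (α : Formula) : Derives upRules α (.and α α) :=
  Derives.cocontraction α (by simp)

theorem up_distrib (α β γ : Formula) :
    Derives upRules (.and (.or α β) γ) (.or (.and α γ) (.and β γ)) :=
  Derives.distrib α β γ (by simp)

theorem up_linear {r : RuleName} {α β : Formula} (h : RuleInstance r α β)
    (hr : r.isStructural = false := by rfl) : Derives upRules α β := Derives.linear h hr

theorem up_and_left (α β : Formula) : Derives upRules (.and α β) α :=
  ((up_coweakening β).and_right α).trans (up_linear (.eqAndUnitDel _))

theorem up_and_right (α β : Formula) : Derives upRules (.and α β) β :=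
  (up_linear (.eqAndComm _ _)).trans (up_and_left β α)

theorem down_ff (α : Formula) : Derives downRules .ff α :=
  Derives.down_of_up (up_coweakening α.dual)

theorem down_contraction (α : Formula) : Derives downRules (.or α α) α :=
  Derives.down_of_up (up_cocontraction α.dual)

theorem UpDown.or_elim {α₁ α₂ β : Formula} (h₁ : UpDown α₁ β) (h₂ : UpDown α₂ β) :
    UpDown (.or α₁ α₂) β :=
  let ⟨γ₁, a₁, b₁⟩ := h₁
  let ⟨γ₂, a₂, b₂⟩ := h₂
  ⟨.or γ₁ γ₂, a₁.or_congr a₂, (b₁.or_congr b₂).trans (down_contraction β)⟩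

/-- The conjunction of a list of literals. -/
def conj (L : List (ℕ × Bool)) : Formula := L.foldr (fun a φ => .and (.atom a.1 a.2) φ) .tt

theorem holds_conj {v : ℕ → Bool} {L : List (ℕ × Bool)} :
    (conj L).Holds v ↔ ∀ a ∈ L, v a.1 = a.2 := by
  induction L with
  | nil => simp [conj, Holds]
  | cons a L ih =>
    rw [List.forall_mem_cons, ← ih]
    rfl

theorem up_conj_append (L L' : List (ℕ × Bool)) :
    Derives upRules (.and (conj L) (conj L')) (conj (L ++ L')) := by
  induction L with
  | nil => exact up_and_right _ _
  | cons a L ih => exact (up_linear (.eqAndAssocL _ _ _)).trans (ih.and_right _)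

theorem up_conj_mem {L : List (ℕ × Bool)} {a : ℕ × Bool} (h : a ∈ L) :
    Derives upRules (conj L) (.atom a.1 a.2) := by
  induction h with
  | head => exact up_and_left _ _
  | tail _ _ ih => exact (up_and_right _ _).trans ih

theorem up_conj_inconsistent {L : List (ℕ × Bool)} {n : ℕ} {b : Bool} (h : (n, b) ∈ L)
    (h' : (n, !b) ∈ L) : Derives upRules (conj L) .ff :=
  (up_cocontraction _).trans <| ((up_conj_mem h).and_congr (up_conj_mem h')).trans <|
    Derives.of_rule (.aiUp n b) (by simp [upRules, linearWith])

/-- Elimination of a formula through the clauses of its disjunctive normal form. -/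
theorem UpDown.of_clauses (α : Formula) : ∀ {χ β : Formula},
    (∀ L, Entails (conj L) α → UpDown (.and (conj L) χ) β) → UpDown (.and α χ) β := by
  induction α with
  | tt => exact fun h => h [] fun _ _ => trivial
  | ff =>
    exact fun _ => ⟨.ff, up_and_left _ _, down_ff _⟩
  | atom n b =>
    intro χ β h
    refine up_trans ((up_linear (.eqAndUnitAdd _)).and_left _) (h [(n, b)] ?_)
    intro v hv
    exact holds_conj.1 hv (n, b) (by simp)
  | or φ ψ ihφ ihψ =>
    intro χ β h
    refine up_trans (up_distrib _ _ _) (or_elim (ihφ fun L hL => h L ?_) (ihψ fun L hL => h L ?_))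
    · exact fun v hv => Or.inl (hL v hv)
    · exact fun v hv => Or.inr (hL v hv)
  | and φ ψ ihφ ihψ =>
    intro χ β h
    refine up_trans (up_linear (.eqAndAssocL _ _ _)) (ihφ fun L hL => ?_)
    refine up_trans ((up_linear (.eqAndAssocR _ _ _)).trans <|
      ((up_linear (.eqAndComm _ _)).and_left _).trans <| up_linear (.eqAndAssocL _ _ _)) ?_
    refine ihψ fun L' hL' => ?_
    refine up_trans ((up_linear (.eqAndAssocR _ _ _)).trans <| (up_conj_append _ _).and_left _) ?_
    refine h (L' ++ L) fun v hv => ⟨hL v ?_, hL' v ?_⟩ <;> rw [holds_conj] at hv ⊢ <;>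
      exact fun a ha => hv a (by simp [ha])

theorem UpDown.of_literals {α β : Formula}
    (h : ∀ L, Entails (conj L) α → UpDown (conj L) β) : UpDown α β :=
  up_trans (up_linear (.eqAndUnitAdd _)) <|
    of_clauses α fun L hL => up_trans (up_and_left _ _) (h L hL)

theorem UpDown.conj_conj {L R : List (ℕ × Bool)} (h : Entails (conj L) (conj R).dual) :
    UpDown (conj L) (conj R).dual := by
  by_cases hc : ∃ n b, (n, b) ∈ L ++ R ∧ (n, !b) ∈ L ++ R
  · obtain ⟨n, b, h₁, h₂⟩ := hc
    rw [List.mem_append] at h₁ h₂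
    have mixed : ∀ {n b}, (n, b) ∈ L → (n, !b) ∈ R → UpDown (conj L) (conj R).dual := by
      intro n b h₁ h₂
      refine ⟨_, up_conj_mem h₁, Derives.down_of_up ?_⟩
      rw [dual_dual]
      exact up_conj_mem h₂
    rcases h₁ with h₁ | h₁ <;> rcases h₂ with h₂ | h₂
    · exact ⟨.ff, up_conj_inconsistent h₁ h₂, down_ff _⟩
    · exact mixed h₁ h₂
    · exact mixed h₂ (by simpa using h₁)
    · refine ⟨.tt, up_coweakening _, Derives.down_of_up ?_⟩
      rw [dual_dual]
      exact up_conj_inconsistent h₁ h₂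
  · exfalso
    push Not at hc
    classical
    let v : ℕ → Bool := fun n => decide ((n, true) ∈ L ++ R)
    have hv : ∀ a ∈ L ++ R, v a.1 = a.2 := by
      rintro ⟨n, b⟩ ha
      cases b with
      | true => simpa [v] using ha
      | false => simpa [v] using hc n false ha
    have hL := h v (holds_conj.2 fun a ha => hv a (by simp [ha]))
    rw [holds_dual, holds_conj] at hL
    exact hL fun a ha => hv a (by simp [ha])

/-- Completeness, in the form of an interpolation theorem. -/
theorem UpDown.of_entails {α β : Formula} (h : Entails α β) : UpDown α β := by
  refine of_literals fun L hL => ?_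
  suffices UpDown β.dual (conj L).dual by simpa using this.dual
  refine of_literals fun R hR => ?_
  suffices UpDown (conj L) (conj R).dual by simpa using this.dual
  refine conj_conj fun v hv => ?_
  have := hR.dual v
  rw [dual_dual] at this
  exact this (h v (hL v hv))

/-! ### Permuting rules. -/

/-- If `P` permutes above `T`, every chain of both can be sorted. -/
theorem exists_sorted_chain {X : Type*} {P T : X → X → Prop}
    (h : ∀ {a b c}, T a b → P b c → ∃ d, P a d ∧ Relation.ReflTransGen T d c) {a c : X}
    (hac : Relation.ReflTransGen (fun x y => P x y ∨ T x y) a c) :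
    ∃ d, Relation.ReflTransGen P a d ∧ Relation.ReflTransGen T d c := by
  have h₁ : ∀ {a b c}, Relation.ReflTransGen T a b → P b c →
      ∃ d, P a d ∧ Relation.ReflTransGen T d c := by
    intro a b c hab
    induction hab generalizing c with
    | refl => exact fun hp => ⟨c, hp, .refl⟩
    | tail _ ht ih =>
      intro hp
      obtain ⟨d, hd, hdc⟩ := h ht hp
      obtain ⟨e, he, hed⟩ := ih hd
      exact ⟨e, he, hed.trans hdc⟩
  induction hac with
  | refl => exact ⟨a, .refl, .refl⟩
  | tail _ hbc ih =>
    obtain ⟨d, hd, hdb⟩ := ih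
    rcases hbc with hp | ht
    · obtain ⟨e, he, hec⟩ := h₁ hdb hp
      exact ⟨e, hd.tail he, hec⟩
    · exact ⟨d, hd, hdb.tail ht⟩

/-- Simultaneous replacement of some atom occurrences `a` by `F a`. -/
inductive Replace (F : ℕ → Bool → Formula) : Formula → Formula → Prop
  | tt : Replace F .tt .tt
  | ff : Replace F .ff .ff
  | atom (n b) : Replace F (.atom n b) (.atom n b)
  | repl (n b) : Replace F (.atom n b) (F n b)
  | or {α β α' β'} : Replace F α α' → Replace F β β' → Replace F (.or α β) (.or α' β')
  | and {α β α' β'} : Replace F α α' → Replace F β β' → Replace F (.and α β) (.and α' β')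

namespace Replace

variable {F : ℕ → Bool → Formula}

theorem refl (α : Formula) : Replace F α α := by
  induction α with
  | tt => exact .tt
  | ff => exact .ff
  | atom n b => exact .atom n b
  | or _ _ h h' => exact .or h h'
  | and _ _ h h' => exact .and h h'

theorem derives {S : Set RuleName} (hF : ∀ n b, Derives S (.atom n b) (F n b)) {α β : Formula}
    (h : Replace F α β) : Derives S α β := by
  induction h with
  | tt => exact .refl _
  | ff => exact .refl _
  | atom n b => exact .refl _
  | repl n b => exact hF n b
  | or _ _ h h' => exact h.or_congr h'
  | and _ _ h h' => exact h.and_congr h'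

theorem of_step {S : Set RuleName}
    (hS : ∀ r ∈ S, ∀ α β, RuleInstance r α β → Replace F α β) {α β : Formula}
    (h : Step S α β) : Replace F α β :=
  Step.rec_context hS (fun _ _ χ h => .or h (refl χ)) (fun _ _ χ h => .or (refl χ) h)
    (fun _ _ χ h => .and h (refl χ)) (fun _ _ χ h => .and (refl χ) h) h

/-- A replacement after a linear rule can be carried out before it. -/
theorem permute_linear {T : Set RuleName} {r : RuleName} (hr : r.isStructural = false)
    {α β γ : Formula} (h : RuleInstance r α β) (hβ : Replace F β γ) :
    ∃ δ, Replace F α δ ∧ Derives (linearWith T) δ γ := by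
  cases h with
  | s α β γ =>
    rcases hβ with _ | _ | _ | _ | ⟨_ | _ | _ | _ | _ | ⟨h₁, h₂⟩, h₃⟩
    exact ⟨_, .and h₁ (.or h₂ h₃), .linear (.s _ _ _)⟩
  | m α β γ δ =>
    rcases hβ with _ | _ | _ | _ | _ | ⟨_ | _ | _ | _ | ⟨h₁, h₂⟩, _ | _ | _ | _ | ⟨h₃, h₄⟩⟩
    exact ⟨_, .or (.and h₁ h₃) (.and h₂ h₄), .linear (.m _ _ _ _)⟩
  | eqOrComm α β =>
    rcases hβ with _ | _ | _ | _ | ⟨h₁, h₂⟩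
    exact ⟨_, .or h₂ h₁, .linear (.eqOrComm _ _)⟩
  | eqAndComm α β =>
    rcases hβ with _ | _ | _ | _ | _ | ⟨h₁, h₂⟩
    exact ⟨_, .and h₂ h₁, .linear (.eqAndComm _ _)⟩
  | eqOrAssocL α β γ =>
    rcases hβ with _ | _ | _ | _ | ⟨h₁, _ | _ | _ | _ | ⟨h₂, h₃⟩⟩
    exact ⟨_, .or (.or h₁ h₂) h₃, .linear (.eqOrAssocL _ _ _)⟩
  | eqOrAssocR α β γ =>
    rcases hβ with _ | _ | _ | _ | ⟨_ | _ | _ | _ | ⟨h₁, h₂⟩, h₃⟩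
    exact ⟨_, .or h₁ (.or h₂ h₃), .linear (.eqOrAssocR _ _ _)⟩
  | eqAndAssocL α β γ =>
    rcases hβ with _ | _ | _ | _ | _ | ⟨h₁, _ | _ | _ | _ | _ | ⟨h₂, h₃⟩⟩
    exact ⟨_, .and (.and h₁ h₂) h₃, .linear (.eqAndAssocL _ _ _)⟩
  | eqAndAssocR α β γ =>
    rcases hβ with _ | _ | _ | _ | _ | ⟨_ | _ | _ | _ | _ | ⟨h₁, h₂⟩, h₃⟩
    exact ⟨_, .and h₁ (.and h₂ h₃), .linear (.eqAndAssocR _ _ _)⟩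
  | eqOrUnitDel α => exact ⟨_, .or hβ .ff, .linear (.eqOrUnitDel _)⟩
  | eqOrUnitAdd α =>
    rcases hβ with _ | _ | _ | _ | ⟨h₁, _ | _⟩
    exact ⟨_, h₁, .linear (.eqOrUnitAdd _)⟩
  | eqAndUnitDel α => exact ⟨_, .and hβ .tt, .linear (.eqAndUnitDel _)⟩
  | eqAndUnitAdd α =>
    rcases hβ with _ | _ | _ | _ | _ | ⟨h₁, _ | _⟩
    exact ⟨_, h₁, .linear (.eqAndUnitAdd _)⟩
  | eqTTDel =>
    rcases hβ with _ | _
    exact ⟨_, .or .tt .tt, .linear .eqTTDel⟩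
  | eqTTAdd =>
    rcases hβ with _ | _ | _ | _ | ⟨_ | _, _ | _⟩
    exact ⟨_, .tt, .linear .eqTTAdd⟩
  | eqFFDel =>
    rcases hβ with _ | _
    exact ⟨_, .and .ff .ff, .linear .eqFFDel⟩
  | eqFFAdd =>
    rcases hβ with _ | _ | _ | _ | _ | ⟨_ | _, _ | _⟩
    exact ⟨_, .ff, .linear .eqFFAdd⟩
  | _ => simp [RuleName.isStructural] at hr

/-- A replacement permutes above a set of rules if it permutes above its structural members. -/
theorem permute {T : Set RuleName}
    (hT : ∀ r ∈ T, ∀ {α β γ}, RuleInstance r α β → Replace F β γ →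
      ∃ δ, Replace F α δ ∧ Derives (linearWith T) δ γ)
    {α β γ : Formula} (h : Step (linearWith T) α β) (hβ : Replace F β γ) :
    ∃ δ, Replace F α δ ∧ Derives (linearWith T) δ γ := by
  revert γ
  refine Step.rec_context (P := fun α β => ∀ {γ}, Replace F β γ →
    ∃ δ, Replace F α δ ∧ Derives (linearWith T) δ γ) ?_ ?_ ?_ ?_ ?_ h
  · rintro r (hr | hr) α β h γ hβ
    · exact permute_linear hr h hβ
    · exact hT r hr h hβ
  · intro α β χ ih γ hβ
    rcases hβ with _ | _ | _ | _ | ⟨h₁, h₂⟩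
    obtain ⟨δ, h, h'⟩ := ih h₁
    exact ⟨_, .or h h₂, h'.or_left _⟩
  · intro α β χ ih γ hβ
    rcases hβ with _ | _ | _ | _ | ⟨h₁, h₂⟩
    obtain ⟨δ, h, h'⟩ := ih h₂
    exact ⟨_, .or h₁ h, h'.or_right _⟩
  · intro α β χ ih γ hβ
    rcases hβ with _ | _ | _ | _ | _ | ⟨h₁, h₂⟩
    obtain ⟨δ, h, h'⟩ := ih h₁
    exact ⟨_, .and h h₂, h'.and_left _⟩
  · intro α β χ ih γ hβ
    rcases hβ with _ | _ | _ | _ | _ | ⟨h₁, h₂⟩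
    obtain ⟨δ, h, h'⟩ := ih h₂
    exact ⟨_, .and h₁ h, h'.and_right _⟩

/-- If one structural rule amounts to a replacement that permutes above the remaining rules,
its instances can be moved to the top of a derivation. -/
theorem exists_sorted {T : Set RuleName} {r : RuleName}
    (hr : ∀ {α β}, RuleInstance r α β → Replace F α β)
    (hF : ∀ n b, RuleInstance r (.atom n b) (F n b))
    (hT : ∀ r ∈ T, ∀ {α β γ}, RuleInstance r α β → Replace F β γ →
      ∃ δ, Replace F α δ ∧ Derives (linearWith T) δ γ)
    {α β : Formula} (h : Derives (linearWith (insert r T)) α β) :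
    ∃ γ, Derives (linearWith {r}) α γ ∧ Derives (linearWith T) γ β := by
  have hsub : ∀ {α β}, Step (linearWith (insert r T)) α β →
      Replace F α β ∨ Step (linearWith T) α β := by
    rintro α β ⟨r', (hr' | rfl | hr'), q, hq⟩
    · exact .inr ⟨r', .inl hr', q, hq⟩
    · refine .inl (of_step (S := {r'}) ?_ ⟨r', rfl, q, hq⟩)
      rintro _ rfl α β h
      exact hr h
    · exact .inr ⟨r', .inr hr', q, hq⟩
  obtain ⟨γ, h₁, h₂⟩ := exists_sorted_chain (fun h h' => permute hT h h')
    (Relation.ReflTransGen.mono (fun _ _ => hsub) _ _ h)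
  refine ⟨γ, ?_, h₂⟩
  clear h₂
  induction h₁ with
  | refl => exact .refl _
  | tail _ hs ih =>
    exact ih.trans (hs.derives fun n b => .of_rule (hF n b) (.inr rfl))

end Replace

/-- In the up-fragment, coweakenings can come first, then cocontractions, then
cointeractions. -/
theorem Derives.sort_up {α β : Formula} (h : Derives upRules α β) :
    ∃ γ δ, Derives (linearWith {.awUp}) α γ ∧ Derives (linearWith {.acUp}) γ δ ∧
      Derives (linearWith {.aiUp}) δ β := by
  obtain ⟨γ, h₁, h₂⟩ := Replace.exists_sorted (F := fun _ _ => .tt) (r := .awUp)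
    (T := {.acUp, .aiUp}) (fun h => by cases h; exact .repl _ _) (fun n b => .awUp n b) (by
      rintro r (rfl | rfl) α β γ h hβ
      · cases h with | acUp n b
        rcases hβ with _ | _ | _ | _ | _ | ⟨_ | _ | _ | _, _ | _ | _ | _⟩
        · exact ⟨_, .atom n b, .of_rule (.acUp n b) (.inr (by simp))⟩
        · exact ⟨_, .atom n b, .linear (.eqAndUnitAdd _)⟩
        · exact ⟨_, .atom n b, (Derives.linear (.eqAndUnitAdd _)).trans (.linear (.eqAndComm _ _))⟩
        · exact ⟨_, .repl n b, .linear (.eqAndUnitAdd _)⟩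
      · cases h with | aiUp n b
        rcases hβ with _ | _
        exact ⟨_, .refl _, .of_rule (.aiUp n b) (.inr (by simp))⟩) h
  obtain ⟨δ, h₃, h₄⟩ := Replace.exists_sorted
    (F := fun n b => .and (.atom n b) (.atom n b)) (r := .acUp)
    (T := {.aiUp}) (fun h => by cases h; exact .repl _ _) (fun n b => .acUp n b) (by
      rintro r rfl α β γ h hβ
      cases h with | aiUp n b
      rcases hβ with _ | _
      exact ⟨_, .refl _, .of_rule (.aiUp n b) (.inr rfl)⟩) h₂
  exact ⟨γ, δ, h₁, h₃, h₄⟩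

/-- In the down-fragment, interactions can come first, then contractions, then weakenings. -/
theorem Derives.sort_down {α β : Formula} (h : Derives downRules α β) :
    ∃ γ δ, Derives (linearWith {.aiDown}) α γ ∧ Derives (linearWith {.acDown}) γ δ ∧
      Derives (linearWith {.awDown}) δ β := by
  obtain ⟨γ, δ, h₁, h₂, h₃⟩ :=
    (h.dual (T := {.awUp, .acUp, .aiUp}) fun _ => downRules_dual).sort_up
  have key : ∀ {r : RuleName} {α β : Formula}, Derives (linearWith {r}) α β →
      Derives (linearWith {r.dual}) β.dual α.dual := by
    intro r α β h
    refine h.dual ?_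
    rintro r' (hr' | rfl)
    · left; cases r' <;> simp_all [RuleName.isStructural, RuleName.dual]
    · exact .inr rfl
  refine ⟨δ.dual, γ.dual, ?_, key h₂, ?_⟩
  · simpa [RuleName.dual] using key h₃
  · simpa [RuleName.dual] using key h₁

/-! ### Derivations whose structural rules come in sorted order. -/

/-- Position of a structural rule in sorted derivations. -/
def FlowLabel.rank : FlowLabel → ℕ
  | .awUp => 0
  | .acUp => 1
  | .aiUp => 2
  | .aiDown => 3
  | .acDown => 4
  | .awDown => 5

/-- The vertex label of a structural rule (with a dummy value for the linear rules). -/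
def RuleName.flowLabel : RuleName → FlowLabel
  | .aiDown => .aiDown
  | .aiUp => .aiUp
  | .awDown => .awDown
  | .awUp => .awUp
  | .acDown => .acDown
  | _ => .acUp

/-- The rank of a rule. -/
def RuleName.rank (r : RuleName) : ℕ := r.flowLabel.rank

namespace Deriv

theorem fml_cons (φ : Formula) (t : RuleName × List Bool × Formula)
    (l : List (RuleName × List Bool × Formula)) {i : ℕ} (hi : i ≤ l.length) :
    (Deriv.mk φ (t :: l)).fml (i + 1) = (Deriv.mk t.2.2 l).fml i := by
  simp only [fml, List.map_cons, List.getD_cons_succ]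
  rw [List.getD_eq_getElem _ _ (by simp; omega), List.getD_eq_getElem _ _ (by simp; omega)]

theorem concl_cons (φ : Formula) (t : RuleName × List Bool × Formula)
    (l : List (RuleName × List Bool × Formula)) :
    (Deriv.mk φ (t :: l)).concl = (Deriv.mk t.2.2 l).concl :=
  fml_cons φ t l le_rfl

theorem wf_nil (φ : Formula) : (Deriv.mk φ []).WF := fun i hi => absurd hi (by simp)

theorem wf_cons {φ : Formula} {t : RuleName × List Bool × Formula}
    {l : List (RuleName × List Bool × Formula)} :
    (Deriv.mk φ (t :: l)).WF ↔ StepAt t.1 t.2.1 φ t.2.2 ∧ (Deriv.mk t.2.2 l).WF := by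
  constructor
  · intro h
    refine ⟨by simpa [fml, stepAt] using h 0 (by simp), fun i hi => ?_⟩
    have := h (i + 1) (by simpa using hi)
    rw [fml_cons φ t l (by simp at hi; omega), fml_cons φ t l (by simp at hi; omega)] at this
    simpa [stepAt] using this
  · rintro ⟨h, h'⟩ i hi
    cases i with
    | zero => simpa [fml, stepAt] using h
    | succ i =>
      simp only [List.length_cons] at hi
      rw [fml_cons φ t l (by omega), fml_cons φ t l (by omega)]
      simpa [stepAt] using h' i (by simpa using hi)

theorem append {l l' : List (RuleName × List Bool × Formula)} {α : Formula}
    (h : (Deriv.mk α l).WF) (h' : (Deriv.mk (Deriv.mk α l).concl l').WF) :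
    (Deriv.mk α (l ++ l')).WF ∧
      (Deriv.mk α (l ++ l')).concl = (Deriv.mk (Deriv.mk α l).concl l').concl := by
  induction l generalizing α with
  | nil => exact ⟨h', rfl⟩
  | cons t l ih =>
    rw [concl_cons] at h'
    rw [wf_cons] at h
    obtain ⟨h₁, h₂⟩ := ih h.2 h'
    rw [List.cons_append, wf_cons, concl_cons, concl_cons]
    exact ⟨⟨h.1, h₁⟩, h₂⟩

/-- The structural rules of the derivation are used in order of increasing rank. -/
def Sorted (Φ : Deriv) : Prop :=
  Φ.steps.Pairwise fun a b =>
    a.1.isStructural = true → b.1.isStructural = true → a.1.rank ≤ b.1.rank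

end Deriv

theorem Derives.exists_deriv {r : RuleName} {α β : Formula} (h : Derives (linearWith {r}) α β) :
    ∃ l, (Deriv.mk α l).WF ∧ (Deriv.mk α l).concl = β ∧
      ∀ t ∈ l, t.1.isStructural = true → t.1 = r := by
  induction h using Relation.ReflTransGen.head_induction_on with
  | refl => exact ⟨[], Deriv.wf_nil _, rfl, by simp⟩
  | head hs _ ih =>
    obtain ⟨l, h₁, h₂, h₃⟩ := ih
    obtain ⟨r', hr', q, hq⟩ := hs
    refine ⟨(r', q, _) :: l, Deriv.wf_cons.2 ⟨hq, h₁⟩, (Deriv.concl_cons _ _ _).trans h₂, ?_⟩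
    rw [List.forall_mem_cons]
    refine ⟨fun h => ?_, h₃⟩
    rcases hr' with hr' | hr'
    · simp_all
    · exact hr'

/-- There is a sorted derivation from `α` to `β` whose structural rules have rank at
least `k`. -/
def SortedFrom (k : ℕ) (α β : Formula) : Prop :=
  ∃ l, (Deriv.mk α l).WF ∧ (Deriv.mk α l).concl = β ∧ (Deriv.mk α l).Sorted ∧
    ∀ t ∈ l, t.1.isStructural = true → k ≤ t.1.rank

theorem SortedFrom.refl (k : ℕ) (α : Formula) : SortedFrom k α α :=
  ⟨[], Deriv.wf_nil _, rfl, List.Pairwise.nil, by simp⟩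

theorem SortedFrom.prepend {k : ℕ} {r : RuleName} {α β γ : Formula}
    (h : Derives (linearWith {r}) α β) (h' : SortedFrom k β γ) (hk : r.rank ≤ k) :
    SortedFrom r.rank α γ := by
  obtain ⟨l, h₁, rfl, h₃⟩ := h.exists_deriv
  obtain ⟨l', h₁', h₂', h₃', h₄'⟩ := h'
  obtain ⟨h₅, h₆⟩ := Deriv.append h₁ h₁'
  refine ⟨l ++ l', h₅, h₆.trans h₂', ?_, ?_⟩
  · refine List.pairwise_append.2 ⟨?_, h₃', ?_⟩
    · refine List.pairwise_of_forall_mem_list fun a ha b hb hsa hsb => ?_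
      rw [h₃ a ha hsa, h₃ b hb hsb]
    · intro a ha b hb hsa hsb
      rw [h₃ a ha hsa]
      exact hk.trans (h₄' b hb hsb)
  · intro t ht hs
    rcases List.mem_append.1 ht with ht | ht
    · rw [h₃ t ht hs]
    · exact hk.trans (h₄' t ht hs)

/-- Every valid implication has a sorted derivation. -/
theorem Formula.Entails.exists_sorted {α β : Formula} (h : Entails α β) :
    ∃ Ψ : Deriv, Ψ.WF ∧ Ψ.prem = α ∧ Ψ.concl = β ∧ Ψ.Sorted := by
  obtain ⟨γ, h₁, h₂⟩ := UpDown.of_entails h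
  obtain ⟨_, _, a₁, a₂, a₃⟩ := h₁.sort_up
  obtain ⟨_, _, b₁, b₂, b₃⟩ := h₂.sort_down
  have h₆ := SortedFrom.prepend b₃ (.refl 5 β) (by decide)
  have h₅ := SortedFrom.prepend b₂ h₆ (by decide)
  have h₄ := SortedFrom.prepend b₁ h₅ (by decide)
  have h₃ := SortedFrom.prepend a₃ h₄ (by decide)
  have h₂ := SortedFrom.prepend a₂ h₃ (by decide)
  obtain ⟨l, h, h', h'', _⟩ := SortedFrom.prepend a₁ h₂ (by decide)
  exact ⟨⟨α, l⟩, h, rfl, h', h''⟩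

/-! ### Labelled formulae.

A formula whose atoms are `(Nat.pair n e, b)` is read as a formula with atoms `(n, b)` whose
occurrences carry the edge names `e`. -/

namespace Formula

/-- The multiset of atoms of a formula. -/
def atoms : Formula → Multiset (ℕ × Bool)
  | .tt => 0
  | .ff => 0
  | .atom n b => {(n, b)}
  | .or α β => atoms α + atoms β
  | .and α β => atoms α + atoms β

/-- Forget the edge names. -/
def erase : Formula → Formula
  | .tt => .tt
  | .ff => .ff
  | .atom k b => .atom k.unpair.1 b
  | .or α β => .or (erase α) (erase β)
  | .and α β => .and (erase α) (erase β)

/-- The edge names occurring in a labelled formula. -/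
def labels (φ : Formula) : Multiset ℕ := φ.atoms.map fun a => a.1.unpair.2

theorem sub_erase : ∀ (φ : Formula) (p : List Bool), φ.erase.sub p = (φ.sub p).map erase
  | φ, [] => by cases φ <;> rfl
  | φ, d :: p => by
    cases φ <;> cases d <;> simp [erase, sub, sub_erase _ p]

theorem repl_erase : ∀ (φ : Formula) (p : List Bool) (χ : Formula),
    (φ.repl p χ).erase = φ.erase.repl p χ.erase
  | φ, [], χ => by cases φ <;> rfl
  | φ, d :: p, χ => by
    cases φ <;> cases d <;> simp [erase, repl, repl_erase _ p]

theorem erase_eq_atom {φ : Formula} {n : ℕ} {b : Bool} (h : φ.erase = .atom n b) :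
    ∃ k, φ = .atom k b ∧ k.unpair.1 = n := by
  cases φ <;> simp_all [erase]

theorem erase_eq_or {φ α β : Formula} (h : φ.erase = .or α β) :
    ∃ α' β', φ = .or α' β' ∧ α'.erase = α ∧ β'.erase = β := by
  cases φ <;> simp_all [erase]

theorem erase_eq_and {φ α β : Formula} (h : φ.erase = .and α β) :
    ∃ α' β', φ = .and α' β' ∧ α'.erase = α ∧ β'.erase = β := by
  cases φ <;> simp_all [erase]

theorem erase_eq_tt {φ : Formula} (h : φ.erase = .tt) : φ = .tt := by
  cases φ <;> simp_all [erase]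

theorem erase_eq_ff {φ : Formula} (h : φ.erase = .ff) : φ = .ff := by
  cases φ <;> simp_all [erase]

theorem isOcc_erase {φ : Formula} {p : List Bool} : φ.erase.IsOcc p ↔ φ.IsOcc p := by
  unfold IsOcc
  rw [sub_erase]
  constructor
  · rintro ⟨n, b, h⟩
    obtain ⟨χ, h, h'⟩ := Option.map_eq_some_iff.1 h
    obtain ⟨k, rfl, _⟩ := erase_eq_atom h'
    exact ⟨k, b, h⟩
  · rintro ⟨k, b, h⟩
    exact ⟨_, b, by rw [h]; rfl⟩

theorem atoms_context {γ : Formula} : ∀ {φ : Formula} {q : List Bool}, φ.sub q = some γ →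
    ∃ R, φ.atoms = R + γ.atoms ∧ ∀ δ : Formula, (φ.repl q δ).atoms = R + δ.atoms
  | φ, [], h => ⟨0, by cases φ <;> simp_all [sub], fun δ => by cases φ <;> simp [repl]⟩
  | φ, d :: q, h => by
    cases φ <;> cases d <;> simp only [sub, reduceCtorEq] at h
    all_goals
      obtain ⟨R, h₁, h₂⟩ := atoms_context h
      rename_i α β
    · exact ⟨R + β.atoms, by simp only [atoms, h₁]; abel,
        fun δ => by simp only [repl, atoms, h₂]; abel⟩
    · exact ⟨R + α.atoms, by simp only [atoms, h₁]; abel,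
        fun δ => by simp only [repl, atoms, h₂]; abel⟩
    · exact ⟨R + β.atoms, by simp only [atoms, h₁]; abel,
        fun δ => by simp only [repl, atoms, h₂]; abel⟩
    · exact ⟨R + α.atoms, by simp only [atoms, h₁]; abel,
        fun δ => by simp only [repl, atoms, h₂]; abel⟩

theorem mem_atoms {φ : Formula} {n : ℕ} {b : Bool} :
    (n, b) ∈ φ.atoms ↔ ∃ p, φ.sub p = some (.atom n b) := by
  constructor
  · induction φ with
    | tt => simp [atoms]
    | ff => simp [atoms]
    | atom m c =>
      intro h
      simp only [atoms, Multiset.mem_singleton, Prod.mk.injEq] at h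
      obtain ⟨rfl, rfl⟩ := h
      exact ⟨[], rfl⟩
    | or α β ihα ihβ =>
      intro h
      rcases Multiset.mem_add.1 h with h | h
      · exact (ihα h).imp' (false :: ·) fun _ h => h
      · exact (ihβ h).imp' (true :: ·) fun _ h => h
    | and α β ihα ihβ =>
      intro h
      rcases Multiset.mem_add.1 h with h | h
      · exact (ihα h).imp' (false :: ·) fun _ h => h
      · exact (ihβ h).imp' (true :: ·) fun _ h => h
  · rintro ⟨p, hp⟩
    obtain ⟨R, h, _⟩ := atoms_context hp
    simp [h, atoms]

theorem mem_labels {φ : Formula} {e : ℕ} :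
    e ∈ φ.labels ↔ ∃ p k b, φ.sub p = some (.atom k b) ∧ k.unpair.2 = e := by
  simp only [labels, Multiset.mem_map, Prod.exists, mem_atoms]
  constructor
  · rintro ⟨k, b, ⟨p, h⟩, h'⟩
    exact ⟨p, k, b, h, h'⟩
  · rintro ⟨p, k, b, h, h'⟩
    exact ⟨k, b, ⟨p, h⟩, h'⟩

/-- The edge name at a position of a labelled formula. -/
def labelAt (φ : Formula) (p : List Bool) : ℕ :=
  match φ.sub p with
  | some (.atom k _) => k.unpair.2
  | _ => 0

theorem labelAt_of_sub {φ : Formula} {p : List Bool} {k : ℕ} {b : Bool}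
    (h : φ.sub p = some (.atom k b)) : φ.labelAt p = k.unpair.2 := by
  simp [labelAt, h]

theorem labelAt_mem {φ : Formula} {p : List Bool} (h : φ.IsOcc p) : φ.labelAt p ∈ φ.labels := by
  obtain ⟨k, b, h⟩ := h
  exact mem_labels.2 ⟨p, k, b, h, (labelAt_of_sub h).symm⟩

theorem exists_labelAt {φ : Formula} {e : ℕ} (h : e ∈ φ.labels) :
    ∃ p, φ.IsOcc p ∧ φ.labelAt p = e := by
  obtain ⟨p, k, b, hp, rfl⟩ := mem_labels.1 h
  exact ⟨p, ⟨k, b, hp⟩, labelAt_of_sub hp⟩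

theorem labelAt_congr {φ ψ : Formula} {p q : List Bool} (h : φ.sub p = ψ.sub q) :
    φ.labelAt p = ψ.labelAt q := by
  simp [labelAt, h]

theorem labels_or (α β : Formula) : (Formula.or α β).labels = α.labels + β.labels := by
  simp [labels, atoms]

theorem labels_and (α β : Formula) : (Formula.and α β).labels = α.labels + β.labels := by
  simp [labels, atoms]

theorem labelAt_injective {φ : Formula} (hφ : φ.labels.Nodup) {p p' : List Bool}
    (h : φ.IsOcc p) (h' : φ.IsOcc p') (he : φ.labelAt p = φ.labelAt p') : p = p' := by
  have binary : ∀ {α β : Formula}, (α.labels + β.labels).Nodup → ∀ {p p'},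
      α.IsOcc p → β.IsOcc p' → α.labelAt p ≠ β.labelAt p' := by
    intro α β hd p p' h h' he
    exact Multiset.disjoint_left.1 (Multiset.nodup_add.1 hd).2.2 (labelAt_mem h)
      (he ▸ labelAt_mem h')
  induction φ generalizing p p' with
  | tt => obtain ⟨_, _, h⟩ := h; cases p <;> simp [sub] at h
  | ff => obtain ⟨_, _, h⟩ := h; cases p <;> simp [sub] at h
  | atom n b =>
    obtain ⟨_, _, h⟩ := h
    obtain ⟨_, _, h'⟩ := h'
    cases p <;> cases p' <;> simp_all [sub]
  | or α β ihα ihβ =>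
    rw [labels_or] at hφ
    obtain ⟨hα, hβ, _⟩ := Multiset.nodup_add.1 hφ
    rcases p with _ | ⟨_ | _, p⟩ <;> rcases p' with _ | ⟨_ | _, p'⟩
    all_goals first
      | (obtain ⟨_, _, h⟩ := h; simp [sub] at h; done)
      | (obtain ⟨_, _, h'⟩ := h'; simp [sub] at h'; done)
      | exact congrArg _ (ihα hα h h' he)
      | exact congrArg _ (ihβ hβ h h' he)
      | exact absurd he (binary hφ h h')
      | exact absurd he.symm (binary hφ h' h)
  | and α β ihα ihβ =>
    rw [labels_and] at hφ
    obtain ⟨hα, hβ, _⟩ := Multiset.nodup_add.1 hφ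
    rcases p with _ | ⟨_ | _, p⟩ <;> rcases p' with _ | ⟨_ | _, p'⟩
    all_goals first
      | (obtain ⟨_, _, h⟩ := h; simp [sub] at h; done)
      | (obtain ⟨_, _, h'⟩ := h'; simp [sub] at h'; done)
      | exact congrArg _ (ihα hα h h' he)
      | exact congrArg _ (ihβ hβ h h' he)
      | exact absurd he (binary hφ h h')
      | exact absurd he.symm (binary hφ h' h)

theorem sub_append {φ γ : Formula} {q : List Bool} (h : φ.sub q = some γ) (p : List Bool) :
    φ.sub (q ++ p) = γ.sub p := by
  induction q generalizing φ with
  | nil => cases φ <;> simp_all [sub]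
  | cons d q ih => cases φ <;> cases d <;> simp_all [sub]

theorem sub_repl_self {φ γ : Formula} {q : List Bool} (h : φ.sub q = some γ) (δ : Formula) :
    (φ.repl q δ).sub q = some δ := by
  induction q generalizing φ with
  | nil => cases φ <;> cases δ <;> rfl
  | cons d q ih => cases φ <;> cases d <;> simp_all [sub, repl]

theorem sub_repl_outside {φ γ : Formula} {q p : List Bool} (h : φ.sub q = some γ)
    (hp : φ.IsOcc p) (hqp : ¬ q <+: p) (δ : Formula) : (φ.repl q δ).sub p = φ.sub p := by
  induction q generalizing φ p with
  | nil => exact absurd (List.nil_prefix) hqp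
  | cons d q ih =>
    obtain ⟨n, b, hp⟩ := hp
    rcases p with _ | ⟨d', p⟩
    · cases φ <;> simp [sub] at h hp
    · rw [List.cons_prefix_cons] at hqp
      cases φ <;> cases d <;> cases d' <;> simp [sub, repl] at h hp hqp ⊢
      all_goals exact ih h ⟨n, b, hp⟩ hqp

/-- Name the edges of a formula by the positions of its atoms, prefixed by `pre`. -/
def initial : Formula → List Bool → Formula
  | .tt, _ => .tt
  | .ff, _ => .ff
  | .atom n b, pre =>
    .atom (Nat.pair n (Nat.pair 0 (Nat.pair (Encodable.encode pre) b.toNat))) b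
  | .or α β, pre => .or (initial α (pre ++ [false])) (initial β (pre ++ [true]))
  | .and α β, pre => .and (initial α (pre ++ [false])) (initial β (pre ++ [true]))

@[simp] theorem erase_initial (φ : Formula) (pre : List Bool) : (φ.initial pre).erase = φ := by
  induction φ generalizing pre <;> simp_all [initial, erase]

/-- The step at which an edge name was created, counted from `1`; it is `0` for edges of the
premiss. -/
def _root_.AF.birth (e : ℕ) : ℕ := e.unpair.1

/-- The polarity recorded in an edge name. -/
def _root_.AF.sign (e : ℕ) : Bool := e.unpair.2.unpair.2 == 1

theorem mem_atoms_initial {φ : Formula} {pre : List Bool} {a : ℕ × Bool}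
    (h : a ∈ (φ.initial pre).atoms) :
    ∃ p, pre <+: p ∧
      a.1.unpair.2 = Nat.pair 0 (Nat.pair (Encodable.encode p) a.2.toNat) := by
  have binary : ∀ {α β : Formula},
      (∀ {pre}, a ∈ (α.initial pre).atoms → ∃ p, pre <+: p ∧
        a.1.unpair.2 = Nat.pair 0 (Nat.pair (Encodable.encode p) a.2.toNat)) →
      (∀ {pre}, a ∈ (β.initial pre).atoms → ∃ p, pre <+: p ∧
        a.1.unpair.2 = Nat.pair 0 (Nat.pair (Encodable.encode p) a.2.toNat)) →
      ∀ {pre}, a ∈ (α.initial (pre ++ [false])).atoms + (β.initial (pre ++ [true])).atoms →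
      ∃ p, pre <+: p ∧
        a.1.unpair.2 = Nat.pair 0 (Nat.pair (Encodable.encode p) a.2.toNat) := by
    intro α β hα hβ pre h
    rcases Multiset.mem_add.1 h with h | h
    · obtain ⟨p, hp, he⟩ := hα h
      exact ⟨p, (List.prefix_append _ _).trans hp, he⟩
    · obtain ⟨p, hp, he⟩ := hβ h
      exact ⟨p, (List.prefix_append _ _).trans hp, he⟩
  induction φ generalizing pre with
  | tt => simp [initial, atoms] at h
  | ff => simp [initial, atoms] at h
  | atom n b =>
    simp only [initial, atoms, Multiset.mem_singleton] at h
    subst h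
    exact ⟨pre, List.prefix_rfl, by simp⟩
  | or α β ihα ihβ => exact binary ihα ihβ h
  | and α β ihα ihβ => exact binary ihα ihβ h

theorem nodup_labels_initial (φ : Formula) (pre : List Bool) : (φ.initial pre).labels.Nodup := by
  have binary : ∀ {α β : Formula} {pre : List Bool}, Disjoint (α.initial (pre ++ [false])).labels
      (β.initial (pre ++ [true])).labels := by
    intro α β pre
    refine Multiset.disjoint_left.2 fun {e} h h' => ?_
    obtain ⟨a, ha, rfl⟩ := Multiset.mem_map.1 h
    obtain ⟨a', ha', he⟩ := Multiset.mem_map.1 h'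
    obtain ⟨p, hp, hpe⟩ := mem_atoms_initial ha
    obtain ⟨p', hp', hpe'⟩ := mem_atoms_initial ha'
    rw [hpe, hpe'] at he
    simp only [Nat.pair_eq_pair, Encodable.encode_inj, true_and] at he
    obtain ⟨rfl, _⟩ := he
    obtain ⟨s, rfl⟩ := hp
    obtain ⟨s', hs⟩ := hp'
    simp at hs
  induction φ generalizing pre with
  | tt => simp [initial, labels, atoms]
  | ff => simp [initial, labels, atoms]
  | atom n b => simp [initial, labels, atoms]
  | or α β ihα ihβ =>
    rw [initial, labels_or]
    exact Multiset.nodup_add.2 ⟨ihα _, ihβ _, binary⟩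
  | and α β ihα ihβ =>
    rw [initial, labels_and]
    exact Multiset.nodup_add.2 ⟨ihα _, ihβ _, binary⟩

end Formula

/-- An atom whose edge is created at step `i`; `j` tells apart edges created simultaneously. -/
def freshAtom (i j n : ℕ) (b : Bool) : Formula :=
  .atom (Nat.pair n (Nat.pair (i + 1) (Nat.pair j b.toNat))) b

/-- Labelled rule instances at step `i`: linear rules keep the edge names, structural rules
create fresh ones. -/
inductive LabelledRule (i : ℕ) : RuleName → Formula → Formula → Prop
  | linear {r γ δ} (h : r.isStructural = false) : RuleInstance r γ δ → LabelledRule i r γ δ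
  | aiDown (n b) : LabelledRule i .aiDown .tt (.or (freshAtom i 0 n b) (freshAtom i 0 n (!b)))
  | aiUp (k k' b) : LabelledRule i .aiUp (.and (.atom k b) (.atom k' (!b))) .ff
  | awDown (n b) : LabelledRule i .awDown .ff (freshAtom i 0 n b)
  | awUp (k b) : LabelledRule i .awUp (.atom k b) .tt
  | acDown (k k' n b) :
      LabelledRule i .acDown (.or (.atom k b) (.atom k' b)) (freshAtom i 0 n b)
  | acUp (k n b) :
      LabelledRule i .acUp (.atom k b) (.and (freshAtom i 0 n b) (freshAtom i 1 n b))

namespace LabelledRule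

variable {i : ℕ} {r : RuleName} {γ δ : Formula}

theorem of_linear (hr : r.isStructural = false) (h : LabelledRule i r γ δ) :
    RuleInstance r γ δ ∧ γ.atoms = δ.atoms := by
  cases h with
  | linear _ h =>
    refine ⟨h, ?_⟩
    cases h <;> simp [RuleName.isStructural] at hr <;> simp only [atoms] <;> try abel
  | _ => simp [RuleName.isStructural] at hr

theorem exists_lift (i : ℕ) {γ' δ' : Formula} (h : RuleInstance r γ' δ') (hγ : γ.erase = γ') :
    ∃ δ, LabelledRule i r γ δ ∧ δ.erase = δ' := by
  cases h with
  | aiDown n b =>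
    obtain rfl := erase_eq_tt hγ
    exact ⟨_, .aiDown n b, by simp [freshAtom, erase]⟩
  | aiUp n b =>
    obtain ⟨_, _, rfl, h₁, h₂⟩ := erase_eq_and hγ
    obtain ⟨k, rfl, _⟩ := erase_eq_atom h₁
    obtain ⟨k', rfl, _⟩ := erase_eq_atom h₂
    exact ⟨_, .aiUp k k' b, rfl⟩
  | awDown n b =>
    obtain rfl := erase_eq_ff hγ
    exact ⟨_, .awDown n b, by simp [freshAtom, erase]⟩
  | awUp n b =>
    obtain ⟨k, rfl, _⟩ := erase_eq_atom hγ
    exact ⟨_, .awUp k b, rfl⟩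
  | acDown n b =>
    obtain ⟨_, _, rfl, h₁, h₂⟩ := erase_eq_or hγ
    obtain ⟨k, rfl, _⟩ := erase_eq_atom h₁
    obtain ⟨k', rfl, _⟩ := erase_eq_atom h₂
    exact ⟨_, .acDown k k' n b, by simp [freshAtom, erase]⟩
  | acUp n b =>
    obtain ⟨k, rfl, _⟩ := erase_eq_atom hγ
    exact ⟨_, .acUp k n b, by simp [freshAtom, erase]⟩
  | s α β χ =>
    obtain ⟨α, _, rfl, rfl, h₂⟩ := erase_eq_and hγ
    obtain ⟨β, χ, rfl, rfl, rfl⟩ := erase_eq_or h₂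
    exact ⟨_, .linear rfl (.s α β χ), rfl⟩
  | m α β χ ξ =>
    obtain ⟨_, _, rfl, h₁, h₂⟩ := erase_eq_or hγ
    obtain ⟨α, β, rfl, rfl, rfl⟩ := erase_eq_and h₁
    obtain ⟨χ, ξ, rfl, rfl, rfl⟩ := erase_eq_and h₂
    exact ⟨_, .linear rfl (.m α β χ ξ), rfl⟩
  | eqOrComm α β =>
    obtain ⟨α, β, rfl, rfl, rfl⟩ := erase_eq_or hγ
    exact ⟨_, .linear rfl (.eqOrComm α β), rfl⟩
  | eqAndComm α β =>
    obtain ⟨α, β, rfl, rfl, rfl⟩ := erase_eq_and hγ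
    exact ⟨_, .linear rfl (.eqAndComm α β), rfl⟩
  | eqOrAssocL α β χ =>
    obtain ⟨_, χ, rfl, h₁, rfl⟩ := erase_eq_or hγ
    obtain ⟨α, β, rfl, rfl, rfl⟩ := erase_eq_or h₁
    exact ⟨_, .linear rfl (.eqOrAssocL α β χ), rfl⟩
  | eqOrAssocR α β χ =>
    obtain ⟨α, _, rfl, rfl, h₁⟩ := erase_eq_or hγ
    obtain ⟨β, χ, rfl, rfl, rfl⟩ := erase_eq_or h₁
    exact ⟨_, .linear rfl (.eqOrAssocR α β χ), rfl⟩
  | eqAndAssocL α β χ =>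
    obtain ⟨_, χ, rfl, h₁, rfl⟩ := erase_eq_and hγ
    obtain ⟨α, β, rfl, rfl, rfl⟩ := erase_eq_and h₁
    exact ⟨_, .linear rfl (.eqAndAssocL α β χ), rfl⟩
  | eqAndAssocR α β χ =>
    obtain ⟨α, _, rfl, rfl, h₁⟩ := erase_eq_and hγ
    obtain ⟨β, χ, rfl, rfl, rfl⟩ := erase_eq_and h₁
    exact ⟨_, .linear rfl (.eqAndAssocR α β χ), rfl⟩
  | eqOrUnitDel α =>
    obtain ⟨α, _, rfl, rfl, h₁⟩ := erase_eq_or hγ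
    obtain rfl := erase_eq_ff h₁
    exact ⟨_, .linear rfl (.eqOrUnitDel α), rfl⟩
  | eqOrUnitAdd α => exact ⟨_, .linear rfl (.eqOrUnitAdd γ), by rw [← hγ]; rfl⟩
  | eqAndUnitDel α =>
    obtain ⟨α, _, rfl, rfl, h₁⟩ := erase_eq_and hγ
    obtain rfl := erase_eq_tt h₁
    exact ⟨_, .linear rfl (.eqAndUnitDel α), rfl⟩
  | eqAndUnitAdd α => exact ⟨_, .linear rfl (.eqAndUnitAdd γ), by rw [← hγ]; rfl⟩
  | eqTTDel =>
    obtain ⟨_, _, rfl, h₁, h₂⟩ := erase_eq_or hγ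
    obtain rfl := erase_eq_tt h₁
    obtain rfl := erase_eq_tt h₂
    exact ⟨_, .linear rfl .eqTTDel, rfl⟩
  | eqTTAdd =>
    obtain rfl := erase_eq_tt hγ
    exact ⟨_, .linear rfl .eqTTAdd, rfl⟩
  | eqFFDel =>
    obtain ⟨_, _, rfl, h₁, h₂⟩ := erase_eq_and hγ
    obtain rfl := erase_eq_ff h₁
    obtain rfl := erase_eq_ff h₂
    exact ⟨_, .linear rfl .eqFFDel, rfl⟩
  | eqFFAdd =>
    obtain rfl := erase_eq_ff hγ
    exact ⟨_, .linear rfl .eqFFAdd, rfl⟩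

theorem new_atoms (hr : r.isStructural = true) (h : LabelledRule i r γ δ) {a : ℕ × Bool}
    (ha : a ∈ δ.atoms) : birth a.1.unpair.2 = i + 1 ∧ sign a.1.unpair.2 = a.2 := by
  cases h <;>
    simp_all only [freshAtom, atoms, Multiset.mem_add, Multiset.mem_singleton,
      Multiset.notMem_zero, Bool.false_eq_true]
  all_goals rename_i b
  · rcases ha with rfl | rfl <;> cases b <;> simp [birth, sign]
  · cases b <;> simp [birth, sign]
  · cases b <;> simp [birth, sign]
  · rcases ha with rfl | rfl <;> cases b <;> simp [birth, sign]

theorem nodup_new (hr : r.isStructural = true) (h : LabelledRule i r γ δ) : δ.labels.Nodup := by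
  cases h with
  | aiDown n b => cases b <;> simp [labels, atoms, freshAtom]
  | linear h => simp_all
  | _ => simp [labels, atoms, freshAtom]

theorem card_labels (hr : r.isStructural = true) (h : LabelledRule i r γ δ) :
    Multiset.card δ.labels = (labDeg r.flowLabel).1 ∧
      Multiset.card γ.labels = (labDeg r.flowLabel).2 := by
  cases h with
  | linear h => simp_all
  | _ => simp [labels, atoms, freshAtom, labDeg, RuleName.flowLabel]

end LabelledRule

/-! ### The atomic flow of a derivation. -/

/-- An inference step between labelled formulae. -/
def LabelledStep (i : ℕ) (r : RuleName) (q : List Bool) (φ ψ : Formula) : Prop :=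
  ∃ γ δ, φ.sub q = some γ ∧ LabelledRule i r γ δ ∧ ψ = φ.repl q δ

theorem StepAt.exists_labelled (i : ℕ) {r : RuleName} {q : List Bool} {φ ψ : Formula}
    (h : StepAt r q φ.erase ψ) : ∃ χ, LabelledStep i r q φ χ ∧ χ.erase = ψ := by
  obtain ⟨γ', δ', h₁, h₂, rfl⟩ := h
  rw [sub_erase] at h₁
  obtain ⟨γ, h₁, hγ⟩ := Option.map_eq_some_iff.1 h₁
  obtain ⟨δ, h₃, rfl⟩ := LabelledRule.exists_lift i h₂ hγ
  exact ⟨_, ⟨γ, δ, h₁, h₃, rfl⟩, repl_erase _ _ _⟩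

/-- A labelling of all the formulae of a derivation. -/
structure Labelling (Φ : Deriv) where
  fml : ℕ → Formula
  fml_zero : fml 0 = Φ.prem.initial []
  erase_fml : ∀ i ≤ Φ.steps.length, (fml i).erase = Φ.fml i
  step : ∀ i < Φ.steps.length,
    LabelledStep i (Φ.stepAt i).1 (Φ.stepAt i).2.1 (fml i) (fml (i + 1))

theorem Deriv.WF.nonempty_labelling {Φ : Deriv} (hΦ : Φ.WF) : Nonempty (Labelling Φ) := by
  have key : ∀ i φ, ∃ χ, i < Φ.steps.length → φ.erase = Φ.fml i →
      LabelledStep i (Φ.stepAt i).1 (Φ.stepAt i).2.1 φ χ ∧ χ.erase = Φ.fml (i + 1) := by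
    intro i φ
    by_cases h : i < Φ.steps.length ∧ φ.erase = Φ.fml i
    · obtain ⟨χ, hχ⟩ := StepAt.exists_labelled i (h.2 ▸ hΦ i h.1)
      exact ⟨χ, fun _ _ => hχ⟩
    · exact ⟨φ, fun h₁ h₂ => absurd ⟨h₁, h₂⟩ h⟩
  choose next hnext using key
  let F : ℕ → Formula := fun i => Nat.rec (Φ.prem.initial []) next i
  have hF : ∀ i ≤ Φ.steps.length, (F i).erase = Φ.fml i := by
    intro i
    induction i with
    | zero => exact fun _ => erase_initial _ _
    | succ i ih => exact fun hi => (hnext i (F i) hi (ih (by omega))).2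
  exact ⟨F, rfl, hF, fun i hi => (hnext i (F i) hi (hF i hi.le)).1⟩

namespace LabelledStep

variable {i : ℕ} {r : RuleName} {q : List Bool} {φ ψ : Formula}

theorem atoms_eq (h : LabelledStep i r q φ ψ) (hr : r.isStructural = false) :
    ψ.atoms = φ.atoms := by
  obtain ⟨γ, δ, h₁, h₂, rfl⟩ := h
  obtain ⟨R, hR, hR'⟩ := atoms_context h₁
  rw [hR, hR', (h₂.of_linear hr).2]

theorem exists_context (h : LabelledStep i r q φ ψ) :
    ∃ γ δ R, φ.sub q = some γ ∧ LabelledRule i r γ δ ∧ ψ = φ.repl q δ ∧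
      φ.atoms = R + γ.atoms ∧ ψ.atoms = R + δ.atoms := by
  obtain ⟨γ, δ, h₁, h₂, rfl⟩ := h
  obtain ⟨R, hR, hR'⟩ := atoms_context h₁
  exact ⟨γ, δ, R, h₁, h₂, rfl, hR, hR' δ⟩

end LabelledStep

namespace Labelling

variable {Φ : Deriv} (L : Labelling Φ)

include L

theorem birth_le_and_sign {i : ℕ} (hi : i ≤ Φ.steps.length) :
    ∀ a ∈ (L.fml i).atoms, birth a.1.unpair.2 ≤ i ∧ sign a.1.unpair.2 = a.2 := by
  induction i with
  | zero =>
    intro a ha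
    rw [L.fml_zero] at ha
    obtain ⟨p, _, h⟩ := mem_atoms_initial ha
    rw [h]
    cases a.2 <;> simp [birth, sign]
  | succ i ih =>
    intro a ha
    have old : a ∈ (L.fml i).atoms → birth a.1.unpair.2 ≤ i + 1 ∧ sign a.1.unpair.2 = a.2 :=
      fun h => ⟨(ih (by omega) a h).1.trans i.le_succ, (ih (by omega) a h).2⟩
    cases hr : (Φ.stepAt i).1.isStructural with
    | false => exact old ((L.step i hi).atoms_eq hr ▸ ha)
    | true =>
      obtain ⟨γ, δ, R, _, h₂, _, h₄, h₅⟩ := (L.step i hi).exists_context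
      rw [h₅] at ha
      rcases Multiset.mem_add.1 ha with ha | ha
      · exact old (h₄ ▸ Multiset.mem_add.2 (.inl ha))
      · exact ⟨(h₂.new_atoms hr ha).1.le, (h₂.new_atoms hr ha).2⟩

theorem birth_le {i e : ℕ} (hi : i ≤ Φ.steps.length) (he : e ∈ (L.fml i).labels) :
    birth e ≤ i := by
  obtain ⟨a, ha, rfl⟩ := Multiset.mem_map.1 he
  exact (L.birth_le_and_sign hi a ha).1

theorem nodup {i : ℕ} (hi : i ≤ Φ.steps.length) : (L.fml i).labels.Nodup := by
  induction i with
  | zero => exact L.fml_zero ▸ nodup_labels_initial _ _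
  | succ i ih =>
    cases hr : (Φ.stepAt i).1.isStructural with
    | false =>
      rw [labels, (L.step i hi).atoms_eq hr]
      exact ih (by omega)
    | true =>
      obtain ⟨γ, δ, R, _, h₂, _, h₄, h₅⟩ := (L.step i hi).exists_context
      have hn := ih (by omega)
      rw [labels, h₄, Multiset.map_add] at hn
      rw [labels, h₅, Multiset.map_add]
      refine Multiset.nodup_add.2 ⟨(Multiset.nodup_add.1 hn).1, h₂.nodup_new hr,
        Multiset.disjoint_left.2 fun {e} he he' => ?_⟩
      obtain ⟨a, ha, rfl⟩ := Multiset.mem_map.1 he'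
      have hb := L.birth_le (i := i) (e := a.1.unpair.2) (by omega)
        (by rw [labels, h₄, Multiset.map_add]; exact Multiset.mem_add.2 (.inl he))
      rw [(h₂.new_atoms hr ha).1] at hb
      omega

/-- The edges above and below the redex of a structural step. -/
theorem exists_redex {i : ℕ} (hi : i < Φ.steps.length)
    (hr : (Φ.stepAt i).1.isStructural = true) :
    ∃ γ δ, (L.fml i).sub (Φ.stepAt i).2.1 = some γ ∧ LabelledRule i (Φ.stepAt i).1 γ δ ∧
      L.fml (i + 1) = (L.fml i).repl (Φ.stepAt i).2.1 δ ∧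
      (∀ e, e ∈ δ.labels ↔ e ∈ (L.fml (i + 1)).labels ∧ birth e = i + 1) ∧
      (∀ e, e ∈ γ.labels ↔ e ∈ (L.fml i).labels ∧ e ∉ (L.fml (i + 1)).labels) ∧
      γ.labels.Nodup ∧ ∀ a ∈ γ.atoms, sign a.1.unpair.2 = a.2 := by
  obtain ⟨γ, δ, R, h₁, h₂, h₃, h₄, h₅⟩ := (L.step i hi).exists_context
  have hn := L.nodup hi.le
  have hold : ∀ e ∈ (L.fml i).labels, birth e ≠ i + 1 := fun e he =>
    ((L.birth_le hi.le he).trans_lt i.lt_succ_self).ne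
  have hnew : ∀ e ∈ δ.labels, birth e = i + 1 := by
    intro e he
    obtain ⟨a, ha, rfl⟩ := Multiset.mem_map.1 he
    exact (h₂.new_atoms hr ha).1
  have h₆ : (L.fml i).labels = (R.map fun a => a.1.unpair.2) + γ.labels := by
    rw [labels, h₄, Multiset.map_add, labels]
  have h₇ : (L.fml (i + 1)).labels = (R.map fun a => a.1.unpair.2) + δ.labels := by
    rw [labels, h₅, Multiset.map_add, labels]
  rw [h₆] at hn
  obtain ⟨_, hγ, hd⟩ := Multiset.nodup_add.1 hn
  rw [Multiset.disjoint_left] at hd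
  refine ⟨γ, δ, h₁, h₂, h₃, fun e => ?_, fun e => ?_, hγ, fun a ha => ?_⟩
  · rw [h₇, Multiset.mem_add]
    refine ⟨fun h => ⟨.inr h, hnew e h⟩, fun ⟨h, hb⟩ => h.resolve_left fun h => ?_⟩
    exact hold e (h₆ ▸ Multiset.mem_add.2 (.inl h)) hb
  · rw [h₇, h₆, Multiset.mem_add, Multiset.mem_add, not_or]
    refine ⟨fun h => ⟨.inr h, fun h' => hd h' h, fun h' => ?_⟩, fun ⟨h, h', _⟩ =>
      h.resolve_left h'⟩
    exact hold e (h₆ ▸ Multiset.mem_add.2 (.inr h)) (hnew e h')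
  · exact (L.birth_le_and_sign hi.le a (h₄ ▸ Multiset.mem_add.2 (.inr ha))).2

theorem mem_of_mem_succ {i e : ℕ} (hi : i < Φ.steps.length)
    (he : e ∈ (L.fml (i + 1)).labels) (hb : birth e ≤ i) : e ∈ (L.fml i).labels := by
  cases hr : (Φ.stepAt i).1.isStructural with
  | false => rwa [labels, (L.step i hi).atoms_eq hr] at he
  | true =>
    obtain ⟨γ, δ, R, _, h₂, _, h₄, h₅⟩ := (L.step i hi).exists_context
    rw [labels, h₅, Multiset.map_add] at he
    rw [labels, h₄, Multiset.map_add]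
    rcases Multiset.mem_add.1 he with he | he
    · exact Multiset.mem_add.2 (.inl he)
    · obtain ⟨a, ha, rfl⟩ := Multiset.mem_map.1 he
      rw [(h₂.new_atoms hr ha).1] at hb
      omega

theorem mem_of_le {i j e : ℕ} (hj : j ≤ Φ.steps.length) (he : e ∈ (L.fml j).labels)
    (hi : birth e ≤ i) (hij : i ≤ j) : e ∈ (L.fml i).labels := by
  induction j, hij using Nat.le_induction with
  | base => exact he
  | succ j hij ih => exact ih (by omega) (L.mem_of_mem_succ hj he (hi.trans hij))

theorem structural_of_birth {i e : ℕ} (hi : i < Φ.steps.length)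
    (he : e ∈ (L.fml (i + 1)).labels) (hb : birth e = i + 1) :
    (Φ.stepAt i).1.isStructural = true := by
  by_contra hr
  rw [labels, (L.step i hi).atoms_eq (by simpa using hr)] at he
  have := L.birth_le hi.le he
  omega

theorem structural_of_last {i e : ℕ} (hi : i < Φ.steps.length) (he : e ∈ (L.fml i).labels)
    (he' : e ∉ (L.fml (i + 1)).labels) : (Φ.stepAt i).1.isStructural = true := by
  by_contra hr
  rw [labels, (L.step i hi).atoms_eq (by simpa using hr)] at he'
  exact he' he

/-- The edge `e` is consumed by step `i`. -/
def EndsAt (e i : ℕ) : Prop :=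
  i < Φ.steps.length ∧ e ∈ (L.fml i).labels ∧ e ∉ (L.fml (i + 1)).labels

theorem not_endsAt_of_mem {e i j : ℕ} (hij : i < j) (hj : j ≤ Φ.steps.length)
    (he : e ∈ (L.fml j).labels) : ¬ L.EndsAt e i := fun ⟨h₁, h₂, h₃⟩ =>
  h₃ (L.mem_of_le hj he ((L.birth_le h₁.le h₂).trans i.le_succ) hij)

theorem EndsAt.unique {e i j : ℕ} (hi : L.EndsAt e i) (hj : L.EndsAt e j) : i = j := by
  rcases lt_trichotomy i j with h | h | h
  · exact absurd hi (L.not_endsAt_of_mem h hj.1.le hj.2.1)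
  · exact h
  · exact absurd hj (L.not_endsAt_of_mem h hi.1.le hi.2.1)

open Classical in
/-- The atomic flow of a labelled derivation. -/
noncomputable def flow : PreFlow where
  V := (Finset.range Φ.steps.length).filter fun i => (Φ.stepAt i).1.isStructural = true
  E := (Finset.range (Φ.steps.length + 1)).biUnion fun i => (L.fml i).labels.toFinset
  η := fun i => (Φ.stepAt i).1.flowLabel
  up := fun e => if birth e = 0 then none else some (birth e - 1)
  lo := fun e => if h : ∃ i, L.EndsAt e i then some h.choose else none

theorem mem_V {v : ℕ} :
    v ∈ L.flow.V ↔ v < Φ.steps.length ∧ (Φ.stepAt v).1.isStructural = true := by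
  simp [flow]

theorem mem_E {e : ℕ} : e ∈ L.flow.E ↔ ∃ i ≤ Φ.steps.length, e ∈ (L.fml i).labels := by
  simp [flow]

theorem up_eq_some {e v : ℕ} : L.flow.up e = some v ↔ birth e = v + 1 := by
  simp only [flow]
  split_ifs with h
  · simp [h]
  · simp only [Option.some.injEq]
    omega

theorem up_eq_none {e : ℕ} : L.flow.up e = none ↔ birth e = 0 := by
  simp [flow]

theorem lo_eq_some {e v : ℕ} : L.flow.lo e = some v ↔ L.EndsAt e v := by
  simp only [flow]
  split_ifs with h
  · simp only [Option.some.injEq]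
    exact ⟨fun hv => hv ▸ h.choose_spec, fun hv => EndsAt.unique L h.choose_spec hv⟩
  · simpa using fun hv => h ⟨v, hv⟩

theorem mem_Ledges {e v : ℕ} (hv : v < Φ.steps.length) :
    e ∈ L.flow.Ledges v ↔ e ∈ (L.fml (v + 1)).labels ∧ birth e = v + 1 := by
  rw [PreFlow.Ledges, Finset.mem_filter, up_eq_some, mem_E]
  constructor
  · rintro ⟨⟨i, hi, he⟩, hb⟩
    exact ⟨L.mem_of_le hi he hb.le (hb ▸ L.birth_le hi he), hb⟩
  · exact fun ⟨he, hb⟩ => ⟨⟨v + 1, hv, he⟩, hb⟩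

theorem mem_Uedges {e v : ℕ} : e ∈ L.flow.Uedges v ↔ L.EndsAt e v := by
  rw [PreFlow.Uedges, Finset.mem_filter, lo_eq_some, mem_E]
  exact ⟨And.right, fun h => ⟨⟨v, h.1.le, h.2.1⟩, h⟩⟩

theorem lt_of_up_lo {e u w : ℕ} (hu : L.flow.up e = some u) (hw : L.flow.lo e = some w) :
    u < w := by
  rw [up_eq_some] at hu
  rw [lo_eq_some] at hw
  have := L.birth_le hw.1.le hw.2.1
  omega

theorem degOK : L.flow.degOK := by
  intro v hv
  obtain ⟨hv, hr⟩ := L.mem_V.1 hv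
  obtain ⟨γ, δ, _, h₂, _, h₄, h₅, h₆, _⟩ := L.exists_redex hv hr
  have hL : L.flow.Ledges v = δ.labels.toFinset := by
    ext e
    rw [L.mem_Ledges hv, Multiset.mem_toFinset, h₄]
  have hU : L.flow.Uedges v = γ.labels.toFinset := by
    ext e
    rw [L.mem_Uedges, Multiset.mem_toFinset, h₅]
    exact and_iff_right hv
  rw [hL, hU, Multiset.toFinset_card_of_nodup (h₂.nodup_new hr),
    Multiset.toFinset_card_of_nodup h₆]
  exact h₂.card_labels hr

theorem endpointsOK : L.flow.endpointsOK := by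
  intro e he
  refine ⟨fun v hv => ?_, fun v hv => ?_⟩
  · obtain ⟨i, hi, he⟩ := L.mem_E.1 he
    rw [up_eq_some] at hv
    have hvi : v + 1 ≤ i := hv ▸ L.birth_le hi he
    exact L.mem_V.2 ⟨by omega, L.structural_of_birth (by omega)
      (L.mem_of_le hi he hv.le hvi) hv⟩
  · obtain ⟨h₁, h₂, h₃⟩ := L.lo_eq_some.1 hv
    exact L.mem_V.2 ⟨h₁, L.structural_of_last h₁ h₂ h₃⟩

theorem acyclic : L.flow.Acyclic := by
  rintro ⟨h, ε, -, hε⟩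
  choose u hu using fun i => Option.isSome_iff_exists.1 (hε i).1
  obtain ⟨i, hi⟩ := Finite.exists_min u
  exact absurd (hi (i + 1)) (L.lt_of_up_lo (hu (i + 1)) ((hε i).2 ▸ hu i)).not_ge

theorem polarityOK : L.flow.PolarityOK sign := by
  intro v hv
  obtain ⟨hv, hr⟩ := L.mem_V.1 hv
  obtain ⟨γ, δ, _, h₂, _, h₄, h₅, h₆, h₇⟩ := L.exists_redex hv hr
  have hE : ∀ e, e ∈ L.flow.edges v ↔ e ∈ δ.labels ∨ e ∈ γ.labels := by
    intro e
    rw [PreFlow.edges, Finset.mem_union, L.mem_Ledges hv, L.mem_Uedges, h₄, h₅]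
    exact or_congr_right (and_iff_right hv)
  have h₈ : ∀ a ∈ δ.atoms, sign a.1.unpair.2 = a.2 := fun a ha => (h₂.new_atoms hr ha).2
  have hη : L.flow.η v = (Φ.stepAt v).1.flowLabel := rfl
  simp only [hE, hη]
  have const : ∀ b, (∀ a ∈ γ.atoms, a.2 = b) → (∀ a ∈ δ.atoms, a.2 = b) →
      ∀ e₁, e₁ ∈ δ.labels ∨ e₁ ∈ γ.labels → ∀ e₂, e₂ ∈ δ.labels ∨ e₂ ∈ γ.labels →
      sign e₁ = sign e₂ := by
    intro b hγ hδ
    suffices h : ∀ e, e ∈ δ.labels ∨ e ∈ γ.labels → sign e = b from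
      fun e₁ h₁ e₂ h₂ => (h e₁ h₁).trans (h e₂ h₂).symm
    rintro e (he | he) <;> obtain ⟨a, ha, rfl⟩ := Multiset.mem_map.1 he
    · exact (h₈ a ha).trans (hδ a ha)
    · exact (h₇ a ha).trans (hγ a ha)
  generalize (Φ.stepAt v).1 = r at h₂ hr ⊢
  cases h₂ with
  | linear h => simp_all
  | aiDown n b =>
    refine ⟨by simp [RuleName.flowLabel], fun _ => ?_⟩
    simp only [freshAtom, atoms, labels, Multiset.mem_add, Multiset.mem_singleton,
      Multiset.map_add, Multiset.map_singleton] at h₈ ⊢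
    exact ⟨_, .inl (.inl rfl), _, .inl (.inr rfl), by
      rw [h₈ _ (.inl rfl), h₈ _ (.inr rfl)]; simp⟩
  | aiUp k k' b =>
    refine ⟨by simp [RuleName.flowLabel], fun _ => ?_⟩
    simp only [atoms, labels, Multiset.mem_add, Multiset.mem_singleton,
      Multiset.map_add, Multiset.map_singleton] at h₇ ⊢
    exact ⟨_, .inr (.inl rfl), _, .inr (.inr rfl), by
      rw [h₇ _ (.inl rfl), h₇ _ (.inr rfl)]; simp⟩
  | awDown n b => simp [RuleName.flowLabel]
  | awUp k b => simp [RuleName.flowLabel]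
  | acDown k k' n b =>
    exact ⟨fun _ => const b (by simp [atoms]) (by simp [atoms, freshAtom]),
      by simp [RuleName.flowLabel]⟩
  | acUp k n b =>
    exact ⟨fun _ => const b (by simp [atoms]) (by simp [atoms, freshAtom]),
      by simp [RuleName.flowLabel]⟩

theorem isFlow : L.flow.IsFlow :=
  ⟨L.degOK, L.endpointsOK, L.acyclic, sign, L.polarityOK⟩

theorem isOcc {i : ℕ} (hi : i ≤ Φ.steps.length) {p : List Bool} :
    (Φ.fml i).IsOcc p ↔ (L.fml i).IsOcc p := by
  rw [← L.erase_fml i hi, isOcc_erase]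

theorem stepCond {i : ℕ} (hi : i < Φ.steps.length) :
    AF.stepCond L.flow (fun i => (L.fml i).labelAt) i i (Φ.stepAt i).1 (Φ.stepAt i).2.1
      (Φ.fml i) (Φ.fml (i + 1)) := by
  obtain ⟨γ, δ, h₁, h₂, h₃⟩ := L.step i hi
  refine ⟨fun p hq hp => ?_, ?_⟩
  · rw [L.isOcc hi.le] at hp
    simp only [h₃]
    exact labelAt_congr (sub_repl_outside h₁ hp hq δ)
  have hφ : ∀ p, (L.fml i).labelAt ((Φ.stepAt i).2.1 ++ p) = γ.labelAt p :=
    fun p => labelAt_congr (sub_append h₁ p)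
  have hψ : ∀ p, (L.fml (i + 1)).labelAt ((Φ.stepAt i).2.1 ++ p) = δ.labelAt p :=
    fun p => labelAt_congr (sub_append (h₃ ▸ sub_repl_self h₁ δ) p)
  have hφ' : (L.fml i).labelAt (Φ.stepAt i).2.1 = γ.labelAt [] := by simpa using hφ []
  have hψ' : (L.fml (i + 1)).labelAt (Φ.stepAt i).2.1 = δ.labelAt [] := by simpa using hψ []
  cases hr : (Φ.stepAt i).1.isStructural with
  | true =>
    obtain ⟨γ', δ', h₁', h₂', h₃', h₄, h₅, h₆, -⟩ := L.exists_redex hi hr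
    obtain rfl : γ = γ' := Option.some_injective _ (h₁.symm.trans h₁')
    have hδ : δ = δ' := by
      have h := sub_repl_self h₁ δ
      rw [← h₃, h₃', sub_repl_self h₁ δ'] at h
      exact Option.some_injective _ h.symm
    subst hδ
    have hη : L.flow.η i = (Φ.stepAt i).1.flowLabel := rfl
    have hup : ∀ e, e ∈ δ.labels → L.flow.up e = some i := fun e he =>
      L.up_eq_some.2 ((h₄ e).1 he).2
    have hlo : ∀ e, e ∈ γ.labels → L.flow.lo e = some i := fun e he =>
      L.lo_eq_some.2 ⟨hi, (h₅ e).1 he⟩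
    have hδ := h₂.nodup_new hr
    clear h₁' h₂' h₃' h₃ h₁ h₄ h₅
    generalize (Φ.stepAt i).2.1 = q at *
    generalize (Φ.stepAt i).1 = r at *
    cases h₂ with
    | linear h => simp_all
    | _ =>
      simp_all [labelAt, sub, freshAtom, labels, atoms, RuleName.flowLabel]
  | false =>
    obtain ⟨h, -⟩ := h₂.of_linear hr
    clear h₂ h₃ h₁
    generalize (Φ.stepAt i).2.1 = q at *
    generalize (Φ.stepAt i).1 = r at *
    cases h <;> simp_all [RuleName.isStructural, corrCond] <;> simp [labelAt, sub]

theorem isAssocFlow (hΦ : Φ.WF) :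
    IsAssocFlow Φ L.flow (fun i => (L.fml i).labelAt) id := by
  refine ⟨hΦ, L.isFlow, fun i p hi hp => ?_, fun e he => ?_, fun i p p' hi hp hp' h => ?_,
    fun p hp => ?_, fun p hp => ?_, fun i hi hr => L.mem_V.2 ⟨hi, hr⟩, fun v hv => ?_,
    fun i j _ _ _ _ h => h, fun i hi => L.stepCond hi⟩
  · have hi := Nat.le_of_lt_succ hi
    exact L.mem_E.2 ⟨i, hi, labelAt_mem ((L.isOcc hi).1 hp)⟩
  · obtain ⟨i, hi, he⟩ := L.mem_E.1 he
    obtain ⟨p, hp, hpe⟩ := exists_labelAt he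
    exact ⟨i, p, Nat.lt_succ_of_le hi, (L.isOcc hi).2 hp, hpe⟩
  · have hi := Nat.le_of_lt_succ hi
    exact labelAt_injective (L.nodup hi) ((L.isOcc hi).1 hp) ((L.isOcc hi).1 hp') h
  · rw [up_eq_none]
    exact Nat.le_zero.1 (L.birth_le (Nat.zero_le _)
      (labelAt_mem ((L.isOcc (Nat.zero_le _)).1 hp)))
  · refine Option.eq_none_iff_forall_ne_some.2 fun v hv => ?_
    rw [lo_eq_some] at hv
    exact L.not_endsAt_of_mem hv.1 le_rfl (labelAt_mem ((L.isOcc le_rfl).1 hp)) hv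
  · obtain ⟨hv, hr⟩ := L.mem_V.1 hv
    exact ⟨v, hv, hr, rfl⟩

theorem rank_le (hΦ : Φ.Sorted) {e u w : ℕ} (he : e ∈ L.flow.E) (hu : L.flow.up e = some u)
    (hw : L.flow.lo e = some w) : (L.flow.η u).rank ≤ (L.flow.η w).rank := by
  obtain ⟨hu', hru⟩ := L.mem_V.1 ((L.endpointsOK e he).1 u hu)
  obtain ⟨hw', hrw⟩ := L.mem_V.1 ((L.endpointsOK e he).2 w hw)
  have h := List.pairwise_iff_getElem.1 hΦ u w hu' hw' (L.lt_of_up_lo hu hw)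
  rw [Deriv.stepAt, List.getD_eq_getElem _ _ hu'] at hru
  rw [Deriv.stepAt, List.getD_eq_getElem _ _ hw'] at hrw
  simpa only [flow, RuleName.rank, Deriv.stepAt, List.getD_eq_getElem _ _ hu',
     List.getD_eq_getElem _ _ hw']
    using h hru hrw

end Labelling

/-! ### Flows with vertices of increasing rank. -/

namespace PreFlow

variable {A : PreFlow}

theorem noIWPath_of_rank_le (hd : A.degOK) (hA : ∀ e ∈ A.E, ∀ u w, A.up e = some u →
    A.lo e = some w → (A.η u).rank ≤ (A.η w).rank) : NoIWPath A := by
  rintro ⟨v, v', l, hv, hv', h, h', hl | hl⟩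
  · obtain ⟨hne, hE, hl, hs, ht⟩ := hl
    have hmem : ∀ i < l.length, l.getD i 0 ∈ A.E := fun i hi => by
      rw [List.getD_eq_getElem _ _ hi]
      exact hE _ (List.getElem_mem hi)
    have hi : ∀ i < l.length, ∃ u, A.up (l.getD i 0) = some u ∧ 3 ≤ (A.η u).rank := by
      intro i
      induction i with
      | zero =>
        refine fun _ => ⟨v, hs, ?_⟩
        rcases h with h | h <;> simp [h, FlowLabel.rank]
      | succ i ih =>
        intro hi
        obtain ⟨u, hu, hr⟩ := ih (by omega)
        obtain ⟨w, _, hw, hw'⟩ := hl i hi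
        exact ⟨w, hw', hr.trans (hA _ (hmem i (by omega)) _ _ hu hw)⟩
    have hpos := List.length_pos_iff.2 hne
    obtain ⟨u, hu, hr⟩ := hi (l.length - 1) (by omega)
    have hle := hr.trans (hA _ (hmem _ (by omega)) _ _ hu ht)
    rcases h' with h' | h' <;> simp [h', FlowLabel.rank] at hle
  · obtain ⟨hne, hE, _, hs, _⟩ := hl
    have hpos := List.length_pos_iff.2 hne
    have hmem : l.reverse.getD 0 0 ∈ A.Ledges v' := by
      refine Finset.mem_filter.2 ⟨?_, hs⟩
      rw [List.getD_eq_getElem _ _ hpos]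
      exact hE _ (List.getElem_mem hpos)
    have hcard := (hd v' hv').1
    have hzero : (labDeg (A.η v')).1 = 0 := by rcases h' with h' | h' <;> rw [h'] <;> rfl
    rw [hzero, Finset.card_eq_zero] at hcard
    simp [hcard] at hmem

theorem normalW_of_rank_le (hA : ∀ e ∈ A.E, ∀ u w, A.up e = some u →
    A.lo e = some w → (A.η u).rank ≤ (A.η w).rank) : NormalW A := by
  have key : ∀ {e u w : ℕ}, e ∈ A.E → A.up e = some u → A.lo e = some w →
      ¬ (A.η w).rank < (A.η u).rank := fun he hu hw => (hA _ he _ _ hu hw).not_gt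
  rintro ⟨B, h | h | h | h | h | h | h⟩
  · obtain ⟨v₁, v₂, e, e₂, e₃, _, _, _, h₁, h₂, he, _, _, _, _, _, hu, hl, _⟩ := h
    exact key he hu hl (by rw [h₁, h₂]; decide)
  · obtain ⟨v₁, v₂, e, e₂, e₃, _, _, _, h₁, h₂, he, _, _, _, _, _, hl, hu, _⟩ := h
    exact key he hu hl (by rw [h₁, h₂]; decide)
  · obtain ⟨v₁, v₂, e, e₂, _, _, _, h₁, h₂, he, _, _, hu, hl, _⟩ := h
    exact key he hu hl (by rw [h₁, h₂]; decide)
  · obtain ⟨v₁, v₂, e, e₂, _, _, _, h₁, h₂, he, _, _, hl, hu, _⟩ := h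
    exact key he hu hl (by rw [h₁, h₂]; decide)
  · obtain ⟨v₁, v₂, e, _, _, _, h₁, h₂, he, hu, hl, _⟩ := h
    exact key he hu hl (by rw [h₁, h₂]; decide)
  · obtain ⟨v₁, v₂, e, e₁, e₂, _, _, _, h₁, h₂, he, _, _, _, _, _, hu, hl, _⟩ := h
    exact key he hu hl (by rw [h₁, h₂]; decide)
  · obtain ⟨v₁, v₂, e, e₁, e₂, _, _, _, h₁, h₂, he, _, _, _, _, _, hl, hu, _⟩ := h
    exact key he hu hl (by rw [h₁, h₂]; decide)

theorem normalC_of_rank_le (hA : ∀ e ∈ A.E, ∀ u w, A.up e = some u →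
    A.lo e = some w → (A.η u).rank ≤ (A.η w).rank) : NormalC A := by
  have key : ∀ {e u w : ℕ}, e ∈ A.E → A.up e = some u → A.lo e = some w →
      ¬ (A.η w).rank < (A.η u).rank := fun he hu hw => (hA _ he _ _ hu hw).not_gt
  rintro ⟨B, h | h | h⟩
  · obtain ⟨v₁, v₂, v₃, e, e₁, e₂, e₃, g₁, g₂, _, _, _, _, h₁, h₂, he, _, _, _, _, _, _, _, _, _,
      _, _, _, _, _, hu, hl, _⟩ := h
    exact key he hu hl (by rw [h₁, h₂]; decide)
  · obtain ⟨v₁, v₂, v₃, e, e₁, e₂, e₃, g₁, g₂, _, _, _, _, h₁, h₂, he, _, _, _, _, _, _, _, _, _,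
      _, _, _, _, _, hl, hu, _⟩ := h
    exact key he hu hl (by rw [h₁, h₂]; decide)
  · obtain ⟨v₁, v₂, v₃, v₄, e, e₁, e₂, e₃, e₄, g₁₁, g₁₂, g₂₁, g₂₂, _, _, _, _, _, _, h₁, h₂,
      he, _, _, _, _, _, _, _, _, _, _, _, _, _, _, _, _, _, _, _, _, _, _, _, _, _, _, hu, hl,
      _⟩ := h
    exact key he hu hl (by rw [h₁, h₂]; decide)

end PreFlow

theorem Deriv.Sorted.hyperStreamlined {Φ : Deriv} (h : Φ.Sorted) (hΦ : Φ.WF) :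
    HyperStreamlined Φ := by
  obtain ⟨L⟩ := hΦ.nonempty_labelling
  have hA : ∀ e ∈ L.flow.E, ∀ u w, L.flow.up e = some u → L.flow.lo e = some w →
      (L.flow.η u).rank ≤ (L.flow.η w).rank := fun e he u w hu hw => L.rank_le h he hu hw
  exact ⟨L.flow, _, _, L.isAssocFlow hΦ, PreFlow.noIWPath_of_rank_le L.degOK hA,
    PreFlow.normalW_of_rank_le hA, PreFlow.normalC_of_rank_le hA⟩

/-- Every SKS derivation can be hyper-streamlined: for every
SKS derivation `Φ` there is a hyper-streamlined SKS derivation with the same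
premiss and the same conclusion as `Φ`. -/
theorem statement_2 (Φ : Deriv) (hΦ : Φ.WF) :
    ∃ Ψ : Deriv, Ψ.WF ∧ Ψ.prem = Φ.prem ∧ Ψ.concl = Φ.concl ∧
      HyperStreamlined Ψ := by
  obtain ⟨Ψ, hΨ, hp, hc, hs⟩ := hΦ.entails.exists_sorted
  exact ⟨Ψ, hΨ, hp, hc, hs.hyperStreamlined hΨ⟩

end AF
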